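/- arXiv:1905.10560 — 2 statements merged into one kernel-verified Lean document; each statement's English description precedes it below -/
import Mathlib

section
/- Let m ≥ 2 and n ≥ 1, and let Gⁿₚ be the perfect m-caterpillar of length n: the tree consisting of a central path on n vertices with exactly m pendant edges (legs) attached to each vertex of the path. If n = 2k then M(Gⁿₚ) is homotopy equivalent to the wedge, over t = 0, 1, …, k, of α_t copies of the sphere S^{k−1+t}, where α_t = C(k+t, k−t)·(m−1)^{2t}. If n = 2k+1 then M(Gⁿₚ) is homotopy equivalent to the wedge, over t = 0, 1, …, k, of β_t copies of the sphere S^{k+t}, where β_t = C(k+1+t, k−t)·(m−1)^{2t+1}. -/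
open SimpleGraph

/-- Two edges (as elements of `Sym2 V`) are incident if they share a vertex. -/
def EdgeIncident {V : Type*} (e f : Sym2 V) : Prop := ∃ v, v ∈ e ∧ v ∈ f

/-- The matching complex of a graph, as the set of its faces:
finite sets of pairwise non-incident edges of `G`. -/
def matchingComplex {V : Type*} (G : SimpleGraph V) : Set (Finset (Sym2 V)) :=
  {m | (∀ e ∈ m, e ∈ G.edgeSet) ∧
    (m : Set (Sym2 V)).Pairwise fun e f => ¬ EdgeIncident e f}

/-- The geometric realization of an abstract simplicial complex, given as a
downward-closed set of finite subsets of the vertex type `α`. -/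
abbrev Realization {α : Type*} (K : Set (Finset α)) : Type _ :=
  { f : α → ℝ // (∀ a, 0 ≤ f a) ∧
      ∃ s ∈ K, (∀ a, f a ≠ 0 → a ∈ s) ∧ ∑ a ∈ s, f a = 1 }

/-- The `n`-dimensional sphere. -/
abbrev SphereD (n : ℕ) : Type :=
  Metric.sphere (0 : EuclideanSpace ℝ (Fin (n + 1))) 1

/-- A basepoint of the `n`-sphere. -/
noncomputable def SphereD.pt (n : ℕ) : SphereD n :=
  ⟨EuclideanSpace.single 0 1, by simp [EuclideanSpace.norm_single]⟩

/-- The relation collapsing all basepoints (and the extra point) of a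
family of pointed spaces to one point. -/
def WedgeRel {ι : Type*} (X : ι → Type*) (pt : ∀ i, X i) :
    ((Σ i, X i) ⊕ Unit) → ((Σ i, X i) ⊕ Unit) → Prop := fun p q =>
  (p = Sum.inr () ∨ ∃ i, p = Sum.inl ⟨i, pt i⟩) ∧
  (q = Sum.inr () ∨ ∃ i, q = Sum.inl ⟨i, pt i⟩)

/-- The wedge sum of a family of pointed spaces (with an extra basepoint, so that
the wedge of the empty family is a one-point space). -/
abbrev PWedge {ι : Type*} (X : ι → Type*) [∀ i, TopologicalSpace (X i)]
    (pt : ∀ i, X i) : Type _ :=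
  Quot (WedgeRel X pt)

/-- A wedge of spheres with prescribed dimensions `d i`. -/
noncomputable abbrev WedgeOfSpheres {ι : Type*} (d : ι → ℕ) : Type _ :=
  PWedge (fun i => SphereD (d i)) (fun i => SphereD.pt (d i))

/-- The caterpillar graph on a central path with `n` vertices, with `m i` pendant
edges (legs) attached to the `i`-th path vertex. -/
def caterpillar (n : ℕ) (m : Fin n → ℕ) :
    SimpleGraph (Fin n ⊕ Σ i : Fin n, Fin (m i)) :=
  SimpleGraph.fromRel fun p q =>
    match p, q with
    | Sum.inl i, Sum.inl j => (i : ℕ) + 1 = (j : ℕ)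
    | Sum.inl i, Sum.inr j => i = j.1
    | _, _ => False

section Collapse

variable {X Y : Type*} [TopologicalSpace X] [TopologicalSpace Y]

/-- A homotopy of maps preserving `A` descends to the quotient `q` collapsing `A`. -/
theorem homotopic_of_collapse {q : C(X, Y)} (hq : Topology.IsQuotientMap q) {A : Set X}
    (hA : ∀ x y, q x = q y ↔ x = y ∨ (x ∈ A ∧ y ∈ A)) {φ : C(X, X)} {φ' : C(Y, Y)}
    (hφ : ∀ x, φ' (q x) = q (φ x))
    (h : ContinuousMap.HomotopicWith φ (ContinuousMap.id X) fun ψ => ∀ x ∈ A, ψ x ∈ A) :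
    φ'.Homotopic (ContinuousMap.id Y) := by
  obtain ⟨H⟩ := h
  have hs := hq.surjective
  have key : ∀ (t : unitInterval) (x : X), q (H (t, Function.surjInv hs (q x))) = q (H (t, x)) := by
    intro t x
    have h1 := Function.surjInv_eq hs (q x)
    rcases (hA _ _).1 h1 with h2 | ⟨h2, h3⟩
    · rw [h2]
    · exact (hA _ _).2 (Or.inr ⟨H.prop t _ h2, H.prop t _ h3⟩)
  refine ⟨⟨⟨fun p => q (H (p.1, Function.surjInv hs p.2)), ?_⟩, ?_, ?_⟩⟩
  · apply hq.continuous_lift_prod_right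
    simp only [key]
    exact q.continuous.comp H.continuous
  · intro y
    obtain ⟨x, rfl⟩ := hs y
    exact (key 0 x).trans (by rw [H.apply_zero]; exact (hφ x).symm)
  · intro y
    obtain ⟨x, rfl⟩ := hs y
    exact (key 1 x).trans (by rw [H.apply_one]; rfl)

/-- Collapsing a subset `A` is a homotopy equivalence as soon as the identity can be deformed,
through maps preserving `A`, to a map which is constant on `A`. -/
theorem nonempty_homotopyEquiv_of_collapse {q : C(X, Y)} (hq : Topology.IsQuotientMap q)
    {A : Set X} (hA : ∀ x y, q x = q y ↔ x = y ∨ (x ∈ A ∧ y ∈ A)) {φ : C(X, X)}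
    (h : ContinuousMap.HomotopicWith φ (ContinuousMap.id X) fun ψ => ∀ x ∈ A, ψ x ∈ A)
    (hc : ∀ x ∈ A, ∀ y ∈ A, φ x = φ y) :
    Nonempty (ContinuousMap.HomotopyEquiv X Y) := by
  have hf : Function.FactorsThrough φ q := by
    intro x y hxy
    rcases (hA _ _).1 hxy with rfl | ⟨h2, h3⟩
    · rfl
    · exact hc _ h2 _ h3
  have hl : ∀ x, hq.lift φ hf (q x) = φ x := fun x =>
    DFunLike.congr_fun (hq.lift_comp φ hf) x
  refine ⟨⟨q, hq.lift φ hf, ?_, ?_⟩⟩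
  · rw [hq.lift_comp]
    obtain ⟨H⟩ := h
    exact ⟨H.toHomotopy⟩
  · exact homotopic_of_collapse hq hA (φ := φ) (fun x => by simp [hl]) h

end Collapse

section Wedge

theorem PWedge.mk_pt {ι : Type*} (X : ι → Type*) (pt : ∀ i, X i) (i : ι) :
    (Quot.mk _ (Sum.inl ⟨i, pt i⟩) : Quot (WedgeRel X pt)) = Quot.mk _ (Sum.inr ()) :=
  Quot.sound ⟨Or.inr ⟨i, rfl⟩, Or.inl rfl⟩

variable {ι : Type*} (X : ι → Type*) [∀ i, TopologicalSpace (X i)] (pt : ∀ i, X i)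

open Classical in
/-- The projection of a wedge onto one of its summands. -/
noncomputable def PWedge.proj (i : ι) : PWedge X pt → X i :=
  Quot.lift (Sum.elim (fun x => if h : x.1 = i then h ▸ x.2 else pt i) fun _ => pt i) (by
    have key : ∀ p : (Σ i, X i) ⊕ Unit, (p = Sum.inr () ∨ ∃ i, p = Sum.inl ⟨i, pt i⟩) →
        Sum.elim (fun x : Σ i, X i => if h : x.1 = i then h ▸ x.2 else pt i)
          (fun _ => pt i) p = pt i := by
      rintro p (rfl | ⟨j, rfl⟩)
      · rfl
      · by_cases h : j = i
        · subst h; simp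
        · simp [h]
    rintro p q ⟨hp, hq⟩
    rw [key p hp, key q hq])

theorem PWedge.continuous_proj (i : ι) : Continuous (PWedge.proj X pt i) := by
  classical
  refine continuous_quot_lift _ ?_
  refine Continuous.sumElim ?_ continuous_const
  rw [continuous_sigma_iff]
  intro j
  by_cases h : j = i
  · subst h; simpa using continuous_id'
  · simpa [h] using continuous_const

theorem PWedge.proj_inl_same (i : ι) (x : X i) :
    PWedge.proj X pt i (Quot.mk _ (Sum.inl ⟨i, x⟩)) = x := by
  simp [PWedge.proj]

theorem PWedge.proj_inl_ne {i j : ι} (h : j ≠ i) (x : X j) :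
    PWedge.proj X pt i (Quot.mk _ (Sum.inl ⟨j, x⟩)) = pt i := by
  simp [PWedge.proj, h]

theorem PWedge.proj_inr (i : ι) :
    PWedge.proj X pt i (Quot.mk _ (Sum.inr ())) = pt i := rfl

theorem PWedge.ext_proj {p q : PWedge X pt}
    (h : ∀ i, PWedge.proj X pt i p = PWedge.proj X pt i q) : p = q := by
  induction p using Quot.ind with | _ p
  induction q using Quot.ind with | _ q
  rcases p with ⟨i, x⟩ | ⟨⟩ <;> rcases q with ⟨j, y⟩ | ⟨⟩
  · by_cases hij : i = j
    · subst hij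
      have := h i
      rw [PWedge.proj_inl_same, PWedge.proj_inl_same] at this
      rw [this]
    · have h1 := h i
      have h2 := h j
      rw [PWedge.proj_inl_same, PWedge.proj_inl_ne _ _ (Ne.symm hij)] at h1
      rw [PWedge.proj_inl_same, PWedge.proj_inl_ne _ _ hij] at h2
      rw [h1, ← h2, PWedge.mk_pt, PWedge.mk_pt]
  · have h1 := h i
    rw [PWedge.proj_inl_same, PWedge.proj_inr] at h1
    rw [h1, PWedge.mk_pt]
  · have h1 := h j
    rw [PWedge.proj_inl_same, PWedge.proj_inr] at h1
    rw [← h1, PWedge.mk_pt]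
  · rfl

instance PWedge.t2Space [∀ i, T2Space (X i)] : T2Space (PWedge X pt) :=
  T2Space.of_injective_continuous (f := fun p i => PWedge.proj X pt i p)
    (fun _ _ h => PWedge.ext_proj X pt fun i => congrFun h i)
    (continuous_pi fun i => PWedge.continuous_proj X pt i)

end Wedge

section SimplexToSphere

variable {d : ℕ}

/-- The smallest coordinate of a vector. -/
noncomputable def minCoord (g : Fin (d + 1) → ℝ) : ℝ :=
  Finset.univ.inf' Finset.univ_nonempty g

theorem continuous_minCoord : Continuous (minCoord (d := d)) :=
  Continuous.finset_inf'_apply _ fun j _ => continuous_apply j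

theorem minCoord_le (g : Fin (d + 1) → ℝ) (j : Fin (d + 1)) : minCoord g ≤ g j :=
  Finset.inf'_le _ (Finset.mem_univ j)

theorem exists_minCoord_eq (g : Fin (d + 1) → ℝ) : ∃ j, minCoord g = g j := by
  obtain ⟨j, -, h⟩ := Finset.exists_mem_eq_inf' Finset.univ_nonempty g
  exact ⟨j, h⟩

theorem minCoord_eq {g : Fin (d + 1) → ℝ} {u : ℝ} (h : ∀ j, u ≤ g j) {j : Fin (d + 1)}
    (hj : g j = u) : minCoord g = u :=
  le_antisymm (hj ▸ minCoord_le g j) (Finset.le_inf' _ _ fun j _ => h j)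

/-- The squared distance of a vector from the diagonal, measured through the differences with the
first coordinate. -/
def spread (g : Fin (d + 1) → ℝ) : ℝ := ∑ j : Fin d, (g j.succ - g 0) ^ 2

theorem continuous_spread : Continuous (spread (d := d)) := by
  unfold spread; fun_prop

theorem spread_nonneg (g : Fin (d + 1) → ℝ) : 0 ≤ spread g :=
  Finset.sum_nonneg fun _ _ => sq_nonneg _

/-- Inverse stereographic projection of the vector `(g j - g 0) / minCoord g`. -/
noncomputable def sphereVec (g : Fin (d + 1) → ℝ) : EuclideanSpace ℝ (Fin (d + 1)) :=
  WithLp.toLp 2 (Fin.cons ((spread g - minCoord g ^ 2) / (spread g + minCoord g ^ 2))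
    fun j : Fin d => 2 * minCoord g * (g j.succ - g 0) / (spread g + minCoord g ^ 2))

theorem sphereVec_zero (g : Fin (d + 1) → ℝ) :
    sphereVec g 0 = (spread g - minCoord g ^ 2) / (spread g + minCoord g ^ 2) := rfl

theorem sphereVec_succ (g : Fin (d + 1) → ℝ) (j : Fin d) :
    sphereVec g j.succ =
      2 * minCoord g * (g j.succ - g 0) / (spread g + minCoord g ^ 2) := rfl

theorem mem_sphere_iff_sum {x : EuclideanSpace ℝ (Fin (d + 1))} :
    x ∈ Metric.sphere (0 : EuclideanSpace ℝ (Fin (d + 1))) 1 ↔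
      x 0 ^ 2 + ∑ j : Fin d, x j.succ ^ 2 = 1 := by
  rw [mem_sphere_zero_iff_norm, ← Fin.sum_univ_succ (fun j => x j ^ 2),
    ← EuclideanSpace.real_norm_sq_eq]
  constructor
  · intro h; rw [h]; norm_num
  · intro h
    have := norm_nonneg x
    nlinarith

theorem sphereVec_mem {g : Fin (d + 1) → ℝ} (h : spread g + minCoord g ^ 2 ≠ 0) :
    sphereVec g ∈ Metric.sphere (0 : EuclideanSpace ℝ (Fin (d + 1))) 1 := by
  rw [mem_sphere_iff_sum]
  simp only [sphereVec_zero, sphereVec_succ]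
  have : ∀ j : Fin d, (2 * minCoord g * (g j.succ - g 0) / (spread g + minCoord g ^ 2)) ^ 2 =
      (2 * minCoord g / (spread g + minCoord g ^ 2)) ^ 2 * (g j.succ - g 0) ^ 2 := by
    intro j; ring
  simp only [this, ← Finset.mul_sum]
  change _ + _ * spread g = 1
  field_simp
  ring

theorem spread_add_pos {g : Fin (d + 1) → ℝ} (h : 0 < minCoord g) :
    0 < spread g + minCoord g ^ 2 := by
  have := spread_nonneg g
  positivity

open Classical in
/-- The map from a simplex to a sphere which collapses the boundary to the basepoint. -/
noncomputable def toSphere (g : Fin (d + 1) → ℝ) : SphereD d :=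
  if h : 0 < minCoord g then ⟨sphereVec g, sphereVec_mem (spread_add_pos h).ne'⟩ else SphereD.pt d

theorem toSphere_of_pos {g : Fin (d + 1) → ℝ} (h : 0 < minCoord g) :
    (toSphere g : EuclideanSpace ℝ (Fin (d + 1))) = sphereVec g := by
  simp [toSphere, h]

theorem pt_zero : (SphereD.pt d : EuclideanSpace ℝ (Fin (d + 1))) 0 = 1 := by
  simp [SphereD.pt]

theorem eq_pt_of_zero {x : SphereD d} (h : x.1 0 = 1) : x = SphereD.pt d := by
  have hx := mem_sphere_iff_sum.1 x.2
  rw [h] at hx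
  have h0 : ∑ j : Fin d, x.1 j.succ ^ 2 = 0 := by linarith
  rw [Finset.sum_eq_zero_iff_of_nonneg fun _ _ => sq_nonneg _] at h0
  ext j
  refine Fin.cases ?_ (fun j => ?_) j
  · rw [h, pt_zero]
  · have := h0 j (Finset.mem_univ _)
    simpa [SphereD.pt] using this

theorem one_sub_sphereVec_zero {g : Fin (d + 1) → ℝ} (h : 0 < minCoord g) :
    1 - sphereVec g 0 = 2 * minCoord g ^ 2 / (spread g + minCoord g ^ 2) := by
  have := spread_add_pos h
  rw [sphereVec_zero]
  field_simp
  ring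

theorem toSphere_eq_pt_iff {g : Fin (d + 1) → ℝ} :
    toSphere g = SphereD.pt d ↔ ¬ 0 < minCoord g := by
  constructor
  · intro h hg
    have h1 := toSphere_of_pos hg
    rw [h] at h1
    have h2 := one_sub_sphereVec_zero hg
    rw [← h1, pt_zero, sub_self] at h2
    have := spread_add_pos hg
    have : 0 < 2 * minCoord g ^ 2 / (spread g + minCoord g ^ 2) := by positivity
    linarith
  · intro h; simp [toSphere, h]

theorem continuousOn_toSphere :
    ContinuousOn (toSphere (d := d)) {g | 0 ≤ minCoord g ∧ 0 < ∑ j, g j} := by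
  have hpos : ∀ g : Fin (d + 1) → ℝ, 0 ≤ minCoord g ∧ 0 < ∑ j, g j →
      spread g + minCoord g ^ 2 ≠ 0 := by
    rintro g ⟨h0, h1⟩ h
    have h2 := spread_nonneg g
    have h3 : spread g = 0 := by nlinarith [sq_nonneg (minCoord g)]
    have h4 : minCoord g = 0 := by nlinarith
    unfold spread at h3
    rw [Finset.sum_eq_zero_iff_of_nonneg fun _ _ => sq_nonneg _] at h3
    have h5 : ∀ j, g j = g 0 := by
      intro j
      refine Fin.cases rfl (fun j => ?_) j
      have := h3 j (Finset.mem_univ _)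
      nlinarith
    obtain ⟨j, hj⟩ := exists_minCoord_eq g
    have h6 : ∀ j, g j = 0 := fun k => by rw [h5 k, ← h5 j, ← hj, h4]
    simp [h6] at h1
  rw [continuousOn_iff_continuous_domRestrict, continuous_induced_rng]
  have heq : ∀ g : {g : Fin (d + 1) → ℝ | 0 ≤ minCoord g ∧ 0 < ∑ j, g j},
      (toSphere g.1 : EuclideanSpace ℝ (Fin (d + 1))) = sphereVec g.1 := by
    intro g
    by_cases h : 0 < minCoord g.1
    · exact toSphere_of_pos h
    · have h0 : minCoord g.1 = 0 := le_antisymm (not_lt.1 h) g.2.1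
      have h1 := hpos _ g.2
      have h2 : (⟨sphereVec g.1, sphereVec_mem h1⟩ : SphereD d) = SphereD.pt d := by
        apply eq_pt_of_zero
        rw [sphereVec_zero, h0] at *
        simp at h1
        simp [h1]
      rw [toSphere_eq_pt_iff.2 h, ← h2]
  change Continuous fun g : {g : Fin (d + 1) → ℝ | 0 ≤ minCoord g ∧ 0 < ∑ j, g j} =>
    (toSphere g.1 : EuclideanSpace ℝ (Fin (d + 1)))
  simp only [heq]
  refine (PiLp.continuous_toLp 2 _).comp (continuous_pi fun j => ?_)
  have c1 := (continuous_minCoord (d := d)).comp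
    (continuous_subtype_val (p := fun g => 0 ≤ minCoord g ∧ 0 < ∑ j, g j))
  have c2 := (continuous_spread (d := d)).comp
    (continuous_subtype_val (p := fun g => 0 ≤ minCoord g ∧ 0 < ∑ j, g j))
  refine Fin.cases ?_ (fun j => ?_) j
  · exact (c2.sub (c1.pow 2)).div (c2.add (c1.pow 2)) fun g => hpos _ g.2
  · refine Continuous.div ?_ (c2.add (c1.pow 2)) fun g => hpos _ g.2
    exact (continuous_const.mul c1).mul
      (((continuous_apply _).comp continuous_subtype_val).sub
        ((continuous_apply _).comp continuous_subtype_val))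

theorem toSphere_injOn {g g' : Fin (d + 1) → ℝ} (hg : 0 < minCoord g) (hg' : 0 < minCoord g')
    (hs : ∑ j, g j = 1) (hs' : ∑ j, g' j = 1) (h : toSphere g = toSphere g') : g = g' := by
  have hv : sphereVec g = sphereVec g' := by rw [← toSphere_of_pos hg, ← toSphere_of_pos hg', h]
  have p1 := spread_add_pos hg
  have p2 := spread_add_pos hg'
  obtain ⟨u, hu⟩ : ∃ u, u = minCoord g := ⟨_, rfl⟩
  obtain ⟨u', hu'⟩ : ∃ u, u = minCoord g' := ⟨_, rfl⟩
  have h0 : ∀ {g : Fin (d + 1) → ℝ} (hg : 0 < minCoord g) (j : Fin d),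
      (g j.succ - g 0) = minCoord g * (sphereVec g j.succ / (1 - sphereVec g 0)) := by
    intro g hg j
    have p1 := spread_add_pos hg
    rw [one_sub_sphereVec_zero hg, sphereVec_succ]
    field_simp
  have h1 : ∀ j, g j - g 0 = u / u' * (g' j - g' 0) := by
    intro j
    refine Fin.cases (by simp) (fun j => ?_) j
    rw [h0 hg, h0 hg', hv, ← hu, ← hu']
    rw [← hu'] at hg'
    field_simp
  rw [← hu] at hg
  rw [← hu'] at hg'
  obtain ⟨i, hi⟩ := exists_minCoord_eq g
  obtain ⟨i', hi'⟩ := exists_minCoord_eq g'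
  have h2 : ∀ j, g j = u / u' * g' j + (g 0 - u / u' * g' 0) := fun j => by linarith [h1 j]
  have e1 : u ≤ u / u' * u' + (g 0 - u / u' * g' 0) := by
    have h3 := minCoord_le g i'
    rw [h2 i', ← hi', ← hu', ← hu] at h3
    exact h3
  have e2 : u / u' * u' + (g 0 - u / u' * g' 0) ≤ u := by
    have h3 := h2 i
    rw [← hi, ← hu] at h3
    have h4 := minCoord_le g' i
    rw [← hu'] at h4
    have : u / u' * u' ≤ u / u' * g' i := by gcongr
    linarith
  have e3 : u / u' * u' = u := by field_simp
  have e4 : g 0 - u / u' * g' 0 = 0 := by linarith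
  simp only [e4, add_zero] at h2
  have e5 : u / u' = 1 := by
    have : ∑ j, g j = u / u' * ∑ j, g' j := by
      rw [Finset.mul_sum]; exact Finset.sum_congr rfl fun j _ => h2 j
    rw [hs, hs'] at this; linarith
  funext j
  rw [h2, e5, one_mul]

theorem exists_toSphere_eq {x : SphereD d} (hx : x ≠ SphereD.pt d) :
    ∃ g : Fin (d + 1) → ℝ, 0 < minCoord g ∧ ∑ j, g j = 1 ∧ toSphere g = x := by
  have hs := mem_sphere_iff_sum.1 x.2
  have hx1 : 0 < 1 - x.1 0 := by
    have h1 : x.1 0 ≠ 1 := fun h => hx (eq_pt_of_zero h)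
    have h2 : 0 ≤ ∑ j : Fin d, x.1 j.succ ^ 2 := Finset.sum_nonneg fun _ _ => sq_nonneg _
    have h3 : x.1 0 ≤ 1 := by nlinarith
    have := lt_of_le_of_ne h3 h1
    linarith
  let y : Fin (d + 1) → ℝ := Fin.cons 0 fun j => x.1 j.succ / (1 - x.1 0)
  let z : Fin (d + 1) → ℝ := fun j => y j + 1 - minCoord y
  have hz : ∀ j, 1 ≤ z j := fun j => by have := minCoord_le y j; simp only [z]; linarith
  have hZ : 0 < ∑ j, z j :=
    Finset.sum_pos (fun j _ => by linarith [hz j]) Finset.univ_nonempty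
  obtain ⟨Z, hZ'⟩ : ∃ Z, Z = ∑ j, z j := ⟨_, rfl⟩
  rw [← hZ'] at hZ
  have hu : minCoord (fun j => z j / Z) = 1 / Z := by
    obtain ⟨i, hi⟩ := exists_minCoord_eq y
    refine minCoord_eq (fun j => ?_) (j := i) ?_
    · have := hz j; gcongr
    · simp only [z, hi]; ring
  have hpos : 0 < minCoord (fun j => z j / Z) := by rw [hu]; positivity
  refine ⟨fun j => z j / Z, hpos, ?_, ?_⟩
  · rw [← Finset.sum_div, ← hZ', div_self hZ.ne']
  · have hdiff : ∀ j : Fin d, z j.succ / Z - z 0 / Z = x.1 j.succ / (1 - x.1 0) / Z := by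
      intro j; simp only [z, y, Fin.cons_succ, Fin.cons_zero]; ring
    have hspread : spread (fun j => z j / Z) = (1 + x.1 0) / (1 - x.1 0) / Z ^ 2 := by
      unfold spread
      simp only [hdiff, div_pow, ← Finset.sum_div]
      have : ∑ j : Fin d, x.1 j.succ ^ 2 = (1 + x.1 0) * (1 - x.1 0) := by linarith
      rw [this]
      field_simp
    have hD : spread (fun j => z j / Z) + minCoord (fun j => z j / Z) ^ 2
        = 2 / (1 - x.1 0) / Z ^ 2 := by
      rw [hspread, hu]; field_simp; ring
    ext j
    rw [toSphere_of_pos hpos]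
    refine Fin.cases ?_ (fun j => ?_) j
    · rw [sphereVec_zero, hD, hspread, hu]
      field_simp
      ring
    · rw [sphereVec_succ, hD, hu, hdiff]
      field_simp

end SimplexToSphere

section Complex

set_option linter.unusedSectionVars false

variable {α κ : Type*} [Fintype α] [DecidableEq α] [Fintype κ] {K : Set (Finset α)}

/-- The support of a point of the realization. -/
noncomputable def Realization.supp (f : Realization K) : Finset α :=
  Finset.univ.filter fun a => f.1 a ≠ 0

theorem Realization.mem_supp {f : Realization K} {a : α} : a ∈ f.supp ↔ f.1 a ≠ 0 := by
  simp [Realization.supp]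

theorem Realization.sum_eq_one_of_subset (f : Realization K) {s : Finset α} (h : f.supp ⊆ s) :
    ∑ a ∈ s, f.1 a = 1 := by
  obtain ⟨-, t, -, ht, h1⟩ := f.2
  have h2 : ∀ t, f.supp ⊆ t → ∑ a ∈ t, f.1 a = ∑ a ∈ f.supp, f.1 a := fun t ht =>
    (Finset.sum_subset ht fun a _ ha => by simpa [Realization.mem_supp] using ha).symm
  rw [h2 s h, ← h2 t fun a ha => ht a (Realization.mem_supp.1 ha), h1]

theorem Realization.sum_eq_one (f : Realization K) : ∑ a, f.1 a = 1 :=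
  f.sum_eq_one_of_subset (Finset.subset_univ _)

/-- A nonnegative function of total mass one supported on a face, as a point of the realization. -/
def Realization.ofFun (g : α → ℝ) (h0 : ∀ a, 0 ≤ g a) (h1 : ∑ a, g a = 1)
    (h : ∃ s ∈ K, ∀ a, g a ≠ 0 → a ∈ s) : Realization K :=
  ⟨g, h0, by
    obtain ⟨s, hs, hg⟩ := h
    refine ⟨s, hs, hg, ?_⟩
    rw [← h1]
    exact Finset.sum_subset (Finset.subset_univ s) fun a _ ha => by
      by_contra h; exact ha (hg a h)⟩

instance Realization.compactSpace : CompactSpace (Realization K) := by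
  have hc : IsCompact (Set.univ.pi fun _ : α => Set.Icc (0 : ℝ) 1) :=
    isCompact_univ_pi fun _ => isCompact_Icc
  suffices h : IsCompact {f : α → ℝ | (∀ a, 0 ≤ f a) ∧
      ∃ s ∈ K, (∀ a, f a ≠ 0 → a ∈ s) ∧ ∑ a ∈ s, f a = 1} from isCompact_iff_compactSpace.1 h
  refine hc.of_isClosed_subset ?_ ?_
  · have : {f : α → ℝ | (∀ a, 0 ≤ f a) ∧ ∃ s ∈ K, (∀ a, f a ≠ 0 → a ∈ s) ∧ ∑ a ∈ s, f a = 1} =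
        {f | ∀ a, 0 ≤ f a} ∩ ⋃ s ∈ K, ({f | ∀ a, a ∉ s → f a = 0} ∩ {f | ∑ a ∈ s, f a = 1}) := by
      ext f
      simp only [Set.mem_ofPred_eq, Set.mem_inter_iff, Set.mem_iUnion, exists_prop, ne_eq,
        not_imp_comm]
    rw [this]
    refine IsClosed.inter ?_
      (Set.Finite.isClosed_biUnion K.toFinite fun s _ => IsClosed.inter ?_ ?_)
    · simp only [Set.ofPred_forall]
      exact isClosed_iInter fun a => isClosed_le continuous_const (continuous_apply a)
    · simp only [Set.ofPred_forall]
      exact isClosed_iInter fun a => isClosed_iInter fun _ =>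
        isClosed_eq (continuous_apply a) continuous_const
    · exact isClosed_eq (by fun_prop) continuous_const
  · rintro f ⟨h0, s, -, hs, h1⟩ a -
    refine ⟨h0 a, ?_⟩
    by_cases ha : a ∈ s
    · rw [← h1]; exact Finset.single_le_sum (fun a _ => h0 a) ha
    · by_contra h
      exact ha (hs a (by intro h'; rw [h'] at h; exact h zero_le_one))

/-- A family of vertices `c j` with forbidden sets `R j`, such that a face avoiding `R j` can be
coned off with apex `c j`, simultaneously for all such `j`. -/
structure ConeFamily (K : Set (Finset α)) (c : κ → α) (R : κ → Finset α) : Prop where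
  down : ∀ s ∈ K, ∀ t ⊆ s, t ∈ K
  empty_mem : ∅ ∈ K
  cone : ∀ s ∈ K, ∀ J : Finset κ, (∀ j ∈ J, Disjoint s (R j)) → s ∪ J.image c ∈ K
  avoid : ∀ j k, c k ∉ R j

/-- The part of the realization covered by the cones. -/
def coned (K : Set (Finset α)) (R : κ → Finset α) : Set (Realization K) :=
  {f | ∃ j, Disjoint f.supp (R j)}

/-- Contiguous maps are homotopic through maps preserving the coned part. -/
theorem homotopicWith_of_contiguous {R : κ → Finset α} (φ ψ : C(Realization K, Realization K))
    (h : ∀ f, ∃ s ∈ K, (φ f).supp ⊆ s ∧ (ψ f).supp ⊆ s ∧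
      (f ∈ coned K R → ∃ j, Disjoint s (R j))) :
    ContinuousMap.HomotopicWith φ ψ fun χ => ∀ f ∈ coned K R, χ f ∈ coned K R := by
  choose s hsK hφ hψ hA using h
  have hsub : ∀ (t : unitInterval) (f : Realization K) (a : α),
      (1 - (t : ℝ)) * (φ f).1 a + t * (ψ f).1 a ≠ 0 → a ∈ s f := by
    intro t f a ha
    by_contra hn
    have h1 : (φ f).1 a = 0 := by
      by_contra h'; exact hn (hφ f (Realization.mem_supp.2 h'))
    have h2 : (ψ f).1 a = 0 := by
      by_contra h'; exact hn (hψ f (Realization.mem_supp.2 h'))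
    simp [h1, h2] at ha
  let H : unitInterval × Realization K → Realization K := fun p =>
    Realization.ofFun (fun a => (1 - (p.1 : ℝ)) * (φ p.2).1 a + p.1 * (ψ p.2).1 a)
      (fun a => add_nonneg (mul_nonneg (by linarith [p.1.2.2]) ((φ p.2).2.1 a))
        (mul_nonneg p.1.2.1 ((ψ p.2).2.1 a)))
      (by rw [Finset.sum_add_distrib, ← Finset.mul_sum, ← Finset.mul_sum,
            Realization.sum_eq_one, Realization.sum_eq_one]; ring)
      ⟨s p.2, hsK p.2, hsub p.1 p.2⟩
  refine ⟨⟨⟨⟨H, ?_⟩, ?_, ?_⟩, ?_⟩⟩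
  · rw [continuous_induced_rng]
    refine continuous_pi fun a => ?_
    have c1 : Continuous fun p : unitInterval × Realization K => (φ p.2).1 a :=
      (continuous_apply a).comp (continuous_subtype_val.comp (φ.continuous.comp continuous_snd))
    have c2 : Continuous fun p : unitInterval × Realization K => (ψ p.2).1 a :=
      (continuous_apply a).comp (continuous_subtype_val.comp (ψ.continuous.comp continuous_snd))
    have c3 : Continuous fun p : unitInterval × Realization K => (p.1 : ℝ) := by fun_prop
    exact ((continuous_const.sub c3).mul c1).add (c3.mul c2)
  · intro f
    apply Subtype.ext
    funext a
    simp [H, Realization.ofFun]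
  · intro f
    apply Subtype.ext
    funext a
    simp [H, Realization.ofFun]
  · intro t f hf
    obtain ⟨j, hj⟩ := hA f hf
    refine ⟨j, hj.mono_left fun a ha => ?_⟩
    exact hsub t f a (Realization.mem_supp.1 ha)

/-- The threshold below which coordinates are discarded. -/
noncomputable def threshold (α : Type*) [Fintype α] : ℝ := ((Fintype.card α : ℝ) + 1)⁻¹

theorem threshold_pos : 0 < threshold α := by unfold threshold; positivity

theorem card_mul_threshold_lt : (Fintype.card α : ℝ) * threshold α < 1 := by
  unfold threshold
  rw [← div_eq_mul_inv, div_lt_one (by positivity)]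
  linarith

theorem truncSum_pos (f : Realization K) : 0 < ∑ a, max (f.1 a - threshold α) 0 := by
  have h1 : ∑ a, (f.1 a - threshold α) ≤ ∑ a, max (f.1 a - threshold α) 0 :=
    Finset.sum_le_sum fun a _ => le_max_left _ _
  rw [Finset.sum_sub_distrib, f.sum_eq_one] at h1
  have := card_mul_threshold_lt (α := α)
  simp at h1
  linarith

/-- The point with coordinates below the threshold discarded, as a function. -/
noncomputable def truncFun (f : Realization K) (a : α) : ℝ :=
  max (f.1 a - threshold α) 0 / ∑ a, max (f.1 a - threshold α) 0

theorem truncFun_nonneg (f : Realization K) (a : α) : 0 ≤ truncFun f a :=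
  div_nonneg (le_max_right _ _) (truncSum_pos f).le

theorem sum_truncFun (f : Realization K) : ∑ a, truncFun f a = 1 := by
  unfold truncFun
  rw [← Finset.sum_div, div_self (truncSum_pos f).ne']

theorem lt_of_truncFun_ne {f : Realization K} {a : α} (h : truncFun f a ≠ 0) :
    threshold α < f.1 a := by
  by_contra hn
  exact h (by rw [truncFun, max_eq_right (by linarith), zero_div])

theorem continuous_coord (a : α) : Continuous fun f : Realization K => f.1 a :=
  (continuous_apply a).comp continuous_subtype_val

theorem continuous_truncFun (a : α) : Continuous fun f : Realization K => truncFun f a := by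
  have h : ∀ a : α, Continuous fun f : Realization K => max (f.1 a - threshold α) 0 := fun a =>
    ((continuous_coord a).sub continuous_const).max continuous_const
  exact (h a).div (continuous_finsetSum _ fun a _ => h a) fun f => (truncSum_pos f).ne'

/-- The weight of the cone `j` at a point. -/
noncomputable def coneWeight (R : κ → Finset α) (f : Realization K) (j : κ) : ℝ :=
  max 0 (threshold α - ∑ a ∈ R j, f.1 a)

theorem coneWeight_nonneg (R : κ → Finset α) (f : Realization K) (j : κ) :
    0 ≤ coneWeight R f j := le_max_left _ _

theorem continuous_coneWeight (R : κ → Finset α) (j : κ) :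
    Continuous fun f : Realization K => coneWeight R f j :=
  continuous_const.max (continuous_const.sub (continuous_finsetSum _ fun a _ => continuous_coord a))

theorem lt_threshold_of_coneWeight_ne {R : κ → Finset α} {f : Realization K} {j : κ}
    (h : coneWeight R f j ≠ 0) {a : α} (ha : a ∈ R j) : f.1 a < threshold α := by
  have h1 : f.1 a ≤ ∑ a ∈ R j, f.1 a := Finset.single_le_sum (fun a _ => f.2.1 a) ha
  by_contra hn
  exact h (max_eq_left (by linarith))

/-- The total weight of the cones at a point. -/
noncomputable def totalWeight (R : κ → Finset α) (f : Realization K) : ℝ :=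
  ∑ j, coneWeight R f j

theorem totalWeight_nonneg (R : κ → Finset α) (f : Realization K) : 0 ≤ totalWeight R f :=
  Finset.sum_nonneg fun j _ => coneWeight_nonneg R f j

theorem continuous_totalWeight (R : κ → Finset α) :
    Continuous fun f : Realization K => totalWeight R f :=
  continuous_finsetSum _ fun j _ => continuous_coneWeight R j

theorem threshold_le_totalWeight {R : κ → Finset α} {f : Realization K} (h : f ∈ coned K R) :
    threshold α ≤ totalWeight R f := by
  obtain ⟨j, hj⟩ := h
  have h1 : ∑ a ∈ R j, f.1 a = 0 := Finset.sum_eq_zero fun a ha => by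
    by_contra h
    exact Finset.disjoint_left.1 hj (Realization.mem_supp.2 h) ha
  have h2 : coneWeight R f j = threshold α := by
    rw [coneWeight, h1, sub_zero, max_eq_right threshold_pos.le]
  rw [← h2]
  exact Finset.single_le_sum (fun j _ => coneWeight_nonneg R f j) (Finset.mem_univ j)

/-- The fraction of the truncated point which is retained after pushing towards the apices. -/
noncomputable def retain (R : κ → Finset α) (f : Realization K) : ℝ :=
  max 0 (1 - 2 * totalWeight R f / threshold α)

theorem retain_add_pos (R : κ → Finset α) (f : Realization K) :
    0 < retain R f + totalWeight R f := by
  rcases (totalWeight_nonneg R f).eq_or_lt with h | h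
  · rw [retain, ← h]; simp
  · have : 0 ≤ retain R f := le_max_left _ _
    linarith

theorem continuous_retain (R : κ → Finset α) :
    Continuous fun f : Realization K => retain R f :=
  continuous_const.max (continuous_const.sub
    ((continuous_const.mul (continuous_totalWeight R)).div_const _))

/-- The mass put on the apices. -/
noncomputable def apexMass (c : κ → α) (R : κ → Finset α) (f : Realization K) (a : α) : ℝ :=
  ∑ j, if c j = a then coneWeight R f j else 0

/-- The point pushed towards the apices of the cones near which it lies, as a function. -/
noncomputable def coneFun (c : κ → α) (R : κ → Finset α) (f : Realization K) (a : α) : ℝ :=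
  (retain R f * truncFun f a + apexMass c R f a) / (retain R f + totalWeight R f)

theorem apexMass_nonneg (c : κ → α) (R : κ → Finset α) (f : Realization K) (a : α) :
    0 ≤ apexMass c R f a :=
  Finset.sum_nonneg fun j _ => by split_ifs; exacts [coneWeight_nonneg R f j, le_rfl]

theorem sum_apexMass (c : κ → α) (R : κ → Finset α) (f : Realization K) :
    ∑ a, apexMass c R f a = totalWeight R f := by
  unfold apexMass totalWeight
  rw [Finset.sum_comm]
  simp

theorem coneFun_nonneg (c : κ → α) (R : κ → Finset α) (f : Realization K) (a : α) :
    0 ≤ coneFun c R f a :=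
  div_nonneg (add_nonneg (mul_nonneg (le_max_left _ _) (truncFun_nonneg f a))
    (apexMass_nonneg c R f a)) (retain_add_pos R f).le

theorem sum_coneFun (c : κ → α) (R : κ → Finset α) (f : Realization K) :
    ∑ a, coneFun c R f a = 1 := by
  unfold coneFun
  rw [← Finset.sum_div, Finset.sum_add_distrib, ← Finset.mul_sum, sum_truncFun, sum_apexMass,
    mul_one, div_self (retain_add_pos R f).ne']

theorem continuous_coneFun (c : κ → α) (R : κ → Finset α) (a : α) :
    Continuous fun f : Realization K => coneFun c R f a := by
  refine Continuous.div (((continuous_retain R).mul (continuous_truncFun a)).add ?_)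
    ((continuous_retain R).add (continuous_totalWeight R)) fun f => (retain_add_pos R f).ne'
  refine continuous_finsetSum _ fun j _ => ?_
  split_ifs
  exacts [continuous_coneWeight R j, continuous_const]

/-- The cones near which a point lies. -/
noncomputable def nearCones (R : κ → Finset α) (f : Realization K) : Finset κ :=
  Finset.univ.filter fun j => coneWeight R f j ≠ 0

theorem mem_apices_of_apexMass_ne {c : κ → α} {R : κ → Finset α} {f : Realization K} {a : α}
    (h : apexMass c R f a ≠ 0) : a ∈ (nearCones R f).image c := by
  obtain ⟨j, -, hj⟩ := Finset.exists_ne_zero_of_sum_ne_zero h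
  have hc : c j = a := by by_contra hc; simp [hc] at hj
  exact Finset.mem_image.2 ⟨j, by simpa [nearCones, hc] using hj, hc⟩

/-- The part of the mass that is contracted to a single apex. -/
noncomputable def contractRatio (R : κ → Finset α) (f : Realization K) : ℝ :=
  max 0 (min 1 (2 * totalWeight R f / threshold α - 1))

theorem continuous_contractRatio (R : κ → Finset α) :
    Continuous fun f : Realization K => contractRatio R f :=
  continuous_const.max (continuous_const.min
    (((continuous_const.mul (continuous_totalWeight R)).div_const _).sub continuous_const))

theorem contractRatio_le_one (R : κ → Finset α) (f : Realization K) : contractRatio R f ≤ 1 :=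
  max_le zero_le_one (min_le_left _ _)

theorem contractRatio_nonneg (R : κ → Finset α) (f : Realization K) : 0 ≤ contractRatio R f :=
  le_max_left _ _

theorem retain_eq_zero {R : κ → Finset α} {f : Realization K} (h : contractRatio R f ≠ 0) :
    retain R f = 0 := by
  refine max_eq_left ?_
  by_contra hn
  refine h (max_eq_left ((min_le_right _ _).trans ?_))
  linarith

theorem contractRatio_eq_one {R : κ → Finset α} {f : Realization K} (h : f ∈ coned K R) :
    contractRatio R f = 1 := by
  have h1 := threshold_le_totalWeight h
  have h2 : 1 ≤ totalWeight R f / threshold α := (one_le_div threshold_pos).2 h1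
  rw [contractRatio, min_eq_left, max_eq_right zero_le_one]
  rw [mul_div_assoc]; linarith

/-- The final stage of the deformation, which contracts the coned part to an apex. -/
noncomputable def contractFun (c : κ → α) (R : κ → Finset α) (o : κ) (f : Realization K) (a : α) :
    ℝ :=
  (1 - contractRatio R f) * coneFun c R f a + contractRatio R f * if c o = a then 1 else 0

theorem contractFun_nonneg (c : κ → α) (R : κ → Finset α) (o : κ) (f : Realization K) (a : α) :
    0 ≤ contractFun c R o f a := by
  have h1 := contractRatio_le_one R f
  have h2 := contractRatio_nonneg R f
  have h3 := coneFun_nonneg c R f a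
  unfold contractFun
  refine add_nonneg (mul_nonneg (by linarith) h3) (mul_nonneg h2 ?_)
  split_ifs <;> norm_num

theorem sum_contractFun (c : κ → α) (R : κ → Finset α) (o : κ) (f : Realization K) :
    ∑ a, contractFun c R o f a = 1 := by
  unfold contractFun
  rw [Finset.sum_add_distrib, ← Finset.mul_sum, ← Finset.mul_sum, sum_coneFun]
  simp

theorem continuous_contractFun (c : κ → α) (R : κ → Finset α) (o : κ) (a : α) :
    Continuous fun f : Realization K => contractFun c R o f a :=
  ((continuous_const.sub (continuous_contractRatio R)).mul (continuous_coneFun c R a)).add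
    ((continuous_contractRatio R).mul continuous_const)

namespace ConeFamily

variable {c : κ → α} {R : κ → Finset α}

theorem supp_mem (hK : ConeFamily K c R) (f : Realization K) : f.supp ∈ K := by
  obtain ⟨-, s, hs, hf, -⟩ := f.2
  exact hK.down s hs _ fun a ha => hf a (Realization.mem_supp.1 ha)

/-- The part of the face of `f` above the threshold together with the apices of nearby cones. -/
theorem near_mem (hK : ConeFamily K c R) (f : Realization K) :
    (Finset.univ.filter fun a => truncFun f a ≠ 0) ∪ (nearCones R f).image c ∈ K := by
  refine hK.cone _ (hK.down _ (hK.supp_mem f) _ fun a ha => ?_) _ fun j hj => ?_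
  · have := lt_of_truncFun_ne (Finset.mem_filter.1 ha).2
    exact Realization.mem_supp.2 (threshold_pos.trans this).ne'
  · rw [Finset.disjoint_left]
    intro a ha ha'
    have h1 := lt_of_truncFun_ne (Finset.mem_filter.1 ha).2
    have h2 := lt_threshold_of_coneWeight_ne (Finset.mem_filter.1 hj).2 ha'
    linarith

theorem apices_mem (hK : ConeFamily K c R) (J : Finset κ) : J.image c ∈ K := by
  simpa using hK.cone ∅ hK.empty_mem J fun j _ => Finset.disjoint_empty_left _

theorem disjoint_apices (hK : ConeFamily K c R) (J : Finset κ) (j : κ) :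
    Disjoint (J.image c) (R j) := by
  rw [Finset.disjoint_left]
  intro a ha
  obtain ⟨k, -, rfl⟩ := Finset.mem_image.1 ha
  exact hK.avoid j k

theorem disjoint_near (hK : ConeFamily K c R) {f : Realization K} (hf : f ∈ coned K R) :
    ∃ j, Disjoint ((Finset.univ.filter fun a => truncFun f a ≠ 0) ∪ (nearCones R f).image c)
      (R j) := by
  obtain ⟨j, hj⟩ := hf
  refine ⟨j, Finset.disjoint_union_left.2 ⟨hj.mono_left fun a ha => ?_, hK.disjoint_apices _ _⟩⟩
  have := lt_of_truncFun_ne (Finset.mem_filter.1 ha).2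
  exact Realization.mem_supp.2 (threshold_pos.trans this).ne'

theorem mem_near_of_coneFun_ne {f : Realization K} {a : α} (h : coneFun c R f a ≠ 0) :
    a ∈ (Finset.univ.filter fun a => truncFun f a ≠ 0) ∪ (nearCones R f).image c := by
  by_contra hn
  rw [Finset.mem_union, not_or] at hn
  have h1 : truncFun f a = 0 := by simpa using hn.1
  have h2 : apexMass c R f a = 0 := by
    by_contra h'; exact hn.2 (mem_apices_of_apexMass_ne h')
  exact h (by simp [coneFun, h1, h2])

/-- The support of the final stage of the deformation lies either in the face carrying the previous
stage or in the simplex of apices. -/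
theorem exists_face_contract (hK : ConeFamily K c R) (o : κ) (f : Realization K) :
    ∃ s ∈ K, (∀ a, coneFun c R f a ≠ 0 → a ∈ s) ∧ (∀ a, contractFun c R o f a ≠ 0 → a ∈ s) ∧
      (f ∈ coned K R → ∃ j, Disjoint s (R j)) := by
  by_cases h : contractRatio R f = 0
  · refine ⟨_, hK.near_mem f, fun a => mem_near_of_coneFun_ne, fun a ha => ?_, hK.disjoint_near⟩
    apply mem_near_of_coneFun_ne
    simpa [contractFun, h] using ha
  · have h1 : ∀ a, coneFun c R f a ≠ 0 → a ∈ Finset.univ.image c := by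
      intro a ha
      have h2 : apexMass c R f a ≠ 0 := by
        intro h'; exact ha (by simp [coneFun, retain_eq_zero h, h'])
      exact Finset.image_subset_image (Finset.subset_univ _) (mem_apices_of_apexMass_ne h2)
    refine ⟨_, hK.apices_mem Finset.univ, h1, fun a ha => ?_, fun _ =>
      ⟨o, hK.disjoint_apices _ _⟩⟩
    by_contra hn
    have h2 : coneFun c R f a = 0 := by
      by_contra h'; exact hn (h1 a h')
    have h3 : c o ≠ a := by
      rintro rfl; exact hn (Finset.mem_image_of_mem c (Finset.mem_univ o))
    exact ha (by simp [contractFun, h2, h3])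

/-- The identity can be deformed, preserving the coned part, to a map which is constant there. -/
theorem exists_contraction (hK : ConeFamily K c R) [Nonempty κ] :
    ∃ φ : C(Realization K, Realization K),
      (ContinuousMap.HomotopicWith φ (ContinuousMap.id _)
        fun χ => ∀ f ∈ coned K R, χ f ∈ coned K R) ∧
      ∀ f ∈ coned K R, ∀ g ∈ coned K R, φ f = φ g := by
  obtain ⟨o⟩ := ‹Nonempty κ›
  let φ₁ : C(Realization K, Realization K) :=
    ⟨fun f => Realization.ofFun (truncFun f) (truncFun_nonneg f) (sum_truncFun f)
      ⟨_, hK.near_mem f, fun a ha => Finset.mem_union_left _ (by simpa using ha)⟩,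
      continuous_induced_rng.2 (continuous_pi continuous_truncFun)⟩
  let φ₂ : C(Realization K, Realization K) :=
    ⟨fun f => Realization.ofFun (coneFun c R f) (coneFun_nonneg c R f) (sum_coneFun c R f)
      ⟨_, hK.near_mem f, fun a => mem_near_of_coneFun_ne⟩,
      continuous_induced_rng.2 (continuous_pi (continuous_coneFun c R))⟩
  let φ₃ : C(Realization K, Realization K) :=
    ⟨fun f => Realization.ofFun (contractFun c R o f) (contractFun_nonneg c R o f)
      (sum_contractFun c R o f)
      (let ⟨s, hs, _, h, _⟩ := hK.exists_face_contract o f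
      ⟨s, hs, h⟩),
      continuous_induced_rng.2 (continuous_pi (continuous_contractFun c R o))⟩
  refine ⟨φ₃, ?_, ?_⟩
  · have h1 : ContinuousMap.HomotopicWith φ₁ (ContinuousMap.id _)
        fun χ => ∀ f ∈ coned K R, χ f ∈ coned K R := by
      refine homotopicWith_of_contiguous _ _ fun f =>
        ⟨f.supp, hK.supp_mem f, fun a ha => ?_, subset_rfl, id⟩
      have := lt_of_truncFun_ne (Realization.mem_supp.1 ha)
      exact Realization.mem_supp.2 (threshold_pos.trans this).ne'
    have h2 : ContinuousMap.HomotopicWith φ₂ φ₁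
        fun χ => ∀ f ∈ coned K R, χ f ∈ coned K R :=
      homotopicWith_of_contiguous _ _ fun f =>
        ⟨_, hK.near_mem f, fun a ha => mem_near_of_coneFun_ne (Realization.mem_supp.1 ha),
          fun a ha => Finset.mem_union_left _
            (Finset.mem_filter.2 ⟨Finset.mem_univ a, Realization.mem_supp.1 ha⟩),
          hK.disjoint_near⟩
    have h3 : ContinuousMap.HomotopicWith φ₃ φ₂
        fun χ => ∀ f ∈ coned K R, χ f ∈ coned K R := by
      refine homotopicWith_of_contiguous _ _ fun f => ?_
      obtain ⟨s, hs, h1, h2, h3⟩ := hK.exists_face_contract o f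
      exact ⟨s, hs, fun a ha => h2 a (Realization.mem_supp.1 ha),
        fun a ha => h1 a (Realization.mem_supp.1 ha), h3⟩
    exact (h3.trans h2).trans h1
  · have h : ∀ f ∈ coned K R, (φ₃ f).1 = fun a => if c o = a then 1 else 0 := by
      intro f hf
      funext a
      change contractFun c R o f a = _
      simp [contractFun, contractRatio_eq_one hf]
    intro f hf g hg
    exact Subtype.ext ((h f hf).trans (h g hg).symm)

end ConeFamily

end Complex

section Wedge

variable {α κ ι : Type*} [Fintype α] [DecidableEq α] [Fintype κ] [Nonempty κ] [Finite ι]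
  {K : Set (Finset α)} {c : κ → α} {R : κ → Finset α}

/-- If the faces which are not coned are the members of an antichain `F`, then the realization is a
wedge of spheres, one for each member of `F`. -/
theorem ConeFamily.nonempty_homotopyEquiv_wedge (hK : ConeFamily K c R) (F : ι → Finset α)
    (d : ι → ℕ) (hcard : ∀ i, (F i).card = d i + 1) (hFK : ∀ i, F i ∈ K)
    (hF : ∀ i j, ¬ Disjoint (F i) (R j)) (hanti : ∀ i i', F i ⊆ F i' → i = i')
    (hcover : ∀ s ∈ K, (∀ j, ¬ Disjoint s (R j)) → ∃ i, F i = s) :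
    Nonempty (ContinuousMap.HomotopyEquiv (Realization K) (WedgeOfSpheres d)) := by
  classical
  let b : ∀ i, Fin (d i + 1) ≃ F i := fun i => ((F i).equivFinOfCardEq (hcard i)).symm
  let r : ∀ i, Realization K → Fin (d i + 1) → ℝ := fun i f j => f.1 (b i j)
  have hr : ∀ i, Continuous (r i) := fun i => continuous_pi fun j => continuous_coord _
  have hr0 : ∀ i f, 0 ≤ minCoord (r i f) := fun i f => by
    obtain ⟨j, hj⟩ := exists_minCoord_eq (r i f)
    rw [hj]; exact f.2.1 _
  have hsum : ∀ i f, ∑ j, r i f j = ∑ a ∈ F i, f.1 a := fun i f => by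
    rw [← Finset.sum_coe_sort (F i)]
    exact (b i).sum_comp fun a => f.1 a
  have hpos : ∀ i f, 0 < minCoord (r i f) ↔ f.supp = F i := by
    intro i f
    constructor
    · intro h
      have hsub : F i ⊆ f.supp := by
        intro a ha
        have h1 := minCoord_le (r i f) ((b i).symm ⟨a, ha⟩)
        simp only [r, Equiv.apply_symm_apply] at h1
        exact Realization.mem_supp.2 (h.trans_le h1).ne'
      obtain ⟨i', hi'⟩ := hcover _ (hK.supp_mem f) fun j hj => hF i j (hj.mono_left hsub)
      rw [← hi'] at hsub ⊢
      rw [hanti _ _ hsub]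
    · intro h
      obtain ⟨j, hj⟩ := exists_minCoord_eq (r i f)
      rw [hj]
      have : ((b i j : F i) : α) ∈ f.supp := h.symm.subset (b i j).2
      exact lt_of_le_of_ne (f.2.1 _) (Realization.mem_supp.1 this).symm
  have hcone : ∀ f : Realization K, f ∈ coned K R ↔ ∀ i, ¬ 0 < minCoord (r i f) := by
    intro f
    constructor
    · rintro ⟨j, hj⟩ i hi
      rw [hpos] at hi
      exact hF i j (hi ▸ hj)
    · intro h
      by_contra hn
      obtain ⟨i, hi⟩ := hcover _ (hK.supp_mem f) fun j hj => hn ⟨j, hj⟩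
      exact h i ((hpos i f).2 hi.symm)
  let q : Realization K → WedgeOfSpheres d := fun f =>
    if h : ∃ i, 0 < minCoord (r i f) then
      Quot.mk _ (Sum.inl ⟨h.choose, toSphere (r h.choose f)⟩)
    else Quot.mk _ (Sum.inr ())
  have hq_face : ∀ i (f : Realization K), f.supp ⊆ F i →
      q f = Quot.mk _ (Sum.inl ⟨i, toSphere (r i f)⟩) := by
    intro i f hf
    by_cases h : ∃ i, 0 < minCoord (r i f)
    · have hi : h.choose = i := by
        have := h.choose_spec
        rw [hpos] at this
        rw [this] at hf
        exact hanti _ _ hf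
      simp only [q, dif_pos h]
      rw [hi]
    · simp only [q, dif_neg h]
      rw [toSphere_eq_pt_iff.2 fun hi => h ⟨i, hi⟩]
      exact (PWedge.mk_pt _ _ i).symm
  have hq_coned : ∀ f ∈ coned K R, q f = Quot.mk _ (Sum.inr ()) := by
    intro f hf
    rw [hcone] at hf
    simp only [q, dif_neg (not_exists.2 hf)]
  have hproj : ∀ i f, PWedge.proj _ _ i (q f) = toSphere (r i f) := by
    intro i f
    by_cases h : ∃ i', 0 < minCoord (r i' f)
    · obtain ⟨i', hi'⟩ := h
      have hs := (hpos _ _).1 hi'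
      rw [hq_face i' f hs.subset]
      by_cases hii : i' = i
      · subst hii
        exact PWedge.proj_inl_same _ _ _ _
      · rw [PWedge.proj_inl_ne _ _ hii, toSphere_eq_pt_iff.2]
        rw [hpos, hs]
        exact fun h => hii (hanti _ _ h.subset)
    · rw [hq_coned f ((hcone f).2 (not_exists.1 h)), toSphere_eq_pt_iff.2 fun hi => h ⟨i, hi⟩]
      exact PWedge.proj_inr _ _ i
  have hfaceclosed : ∀ s : Finset α, IsClosed {f : Realization K | f.supp ⊆ s} := by
    intro s
    have : {f : Realization K | f.supp ⊆ s} = ⋂ a ∈ sᶜ, {f | f.1 a = 0} := by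
      ext f
      simp only [Set.mem_ofPred_eq, Set.mem_iInter, Finset.mem_compl, Finset.subset_iff,
        Realization.mem_supp, ne_eq, not_imp_comm]
    rw [this]
    exact isClosed_biInter fun a _ => isClosed_eq (continuous_coord a) continuous_const
  have hconedclosed : IsClosed (coned K R) := by
    have : coned K R = ⋃ j, {f : Realization K | f.supp ⊆ (R j)ᶜ} := by
      ext f
      simp only [coned, Set.mem_ofPred_eq, Set.mem_iUnion, Finset.subset_compl_iff_disjoint_right]
    rw [this]
    exact isClosed_iUnion_of_finite fun j => hfaceclosed _
  have hqcont : Continuous q := by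
    let C : Option ι → Set (Realization K) := fun o =>
      o.elim (coned K R) fun i => {f | f.supp ⊆ F i}
    refine (locallyFinite_of_finite C).continuous (?_ : (⋃ o, C o) = Set.univ) ?_ ?_
    · rw [Set.eq_univ_iff_forall]
      intro f
      by_cases h : ∃ i, 0 < minCoord (r i f)
      · obtain ⟨i, hi⟩ := h
        exact Set.mem_iUnion.2 ⟨some i, ((hpos i f).1 hi).subset⟩
      · exact Set.mem_iUnion.2 ⟨none, (hcone f).2 (not_exists.1 h)⟩
    · rintro (_ | i)
      exacts [hconedclosed, hfaceclosed _]
    · rintro (_ | i)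
      · exact continuousOn_const.congr hq_coned
      · have h1 : ContinuousOn (fun f : Realization K => toSphere (r i f)) (C (some i)) := by
          refine continuousOn_toSphere.comp (hr i).continuousOn fun f hf => ⟨hr0 i f, ?_⟩
          rw [hsum, f.sum_eq_one_of_subset hf]
          exact one_pos
        have h2 : Continuous fun x : SphereD (d i) =>
            (Quot.mk _ (Sum.inl ⟨i, x⟩) : WedgeOfSpheres d) :=
          continuous_quot_mk.comp (continuous_inl.comp continuous_sigmaMk)
        exact (h2.comp_continuousOn h1).congr fun f hf => hq_face i f hf
  obtain ⟨φ, hφ, hφc⟩ := hK.exists_contraction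
  have hne : ∃ f : Realization K, f ∈ coned K R := by
    obtain ⟨o⟩ := ‹Nonempty κ›
    refine ⟨Realization.ofFun (fun a => if c o = a then 1 else 0)
      (fun a => by split_ifs <;> norm_num) (by simp)
      ⟨{c o}, by simpa using hK.apices_mem {o}, fun a ha => ?_⟩, o, ?_⟩
    · by_contra h
      simp only [Finset.mem_singleton] at h
      exact ha (if_neg (Ne.symm h))
    · rw [Finset.disjoint_left]
      intro a ha
      have h : c o = a := by
        by_contra h
        exact Realization.mem_supp.1 ha (if_neg h)
      rw [← h]
      exact hK.avoid o o
  have hsurj : Function.Surjective q := by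
    intro y
    induction y using Quot.ind with | _ y
    have hbase : ∃ f, q f = Quot.mk _ (Sum.inr ()) := by
      obtain ⟨f, hf⟩ := hne
      exact ⟨f, hq_coned f hf⟩
    rcases y with ⟨i, x⟩ | ⟨⟩
    · by_cases hx : x = SphereD.pt (d i)
      · subst hx
        rw [PWedge.mk_pt]
        exact hbase
      · obtain ⟨g, hg, hg1, rfl⟩ := exists_toSphere_eq hx
        let e : α → ℝ := fun a => if h : a ∈ F i then g ((b i).symm ⟨a, h⟩) else 0
        have he0 : ∀ a, 0 ≤ e a := fun a => by
          simp only [e]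
          split_ifs
          exacts [hg.le.trans (minCoord_le _ _), le_rfl]
        have heF : ∀ a, e a ≠ 0 → a ∈ F i := fun a ha => by
          by_contra h; exact ha (dif_neg h)
        have heb : ∀ j, e (b i j) = g j := fun j => by simp [e]
        have he1 : ∑ a, e a = 1 := by
          rw [← Finset.sum_subset (Finset.subset_univ (F i)) fun a _ ha => by
            by_contra h; exact ha (heF a h), ← hg1, ← Finset.sum_coe_sort (F i),
            ← (b i).sum_comp]
          exact Finset.sum_congr rfl fun j _ => heb j
        refine ⟨Realization.ofFun e he0 he1 ⟨F i, hFK i, heF⟩, ?_⟩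
        rw [hq_face i _ fun a ha => heF a (Realization.mem_supp.1 ha)]
        have : r i (Realization.ofFun e he0 he1 ⟨F i, hFK i, heF⟩) = g := funext heb
        rw [this]
    · exact hbase
  have hker : ∀ f g, q f = q g ↔ f = g ∨ (f ∈ coned K R ∧ g ∈ coned K R) := by
    intro f g
    constructor
    · intro h
      have hθ : ∀ i, toSphere (r i f) = toSphere (r i g) := fun i => by
        rw [← hproj, ← hproj, h]
      have hiff : ∀ i, 0 < minCoord (r i f) ↔ 0 < minCoord (r i g) := fun i => by
        rw [← not_iff_not, ← toSphere_eq_pt_iff, ← toSphere_eq_pt_iff, hθ]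
      by_cases hf : f ∈ coned K R
      · refine Or.inr ⟨hf, ?_⟩
        rw [hcone] at hf ⊢
        exact fun i hi => hf i ((hiff i).2 hi)
      · rw [hcone] at hf
        push Not at hf
        obtain ⟨i, hi⟩ := hf
        have hi' := (hiff i).1 hi
        have hfs := (hpos i f).1 hi
        have hgs := (hpos i g).1 hi'
        have heq : r i f = r i g := toSphere_injOn hi hi'
          (by rw [hsum, f.sum_eq_one_of_subset hfs.subset])
          (by rw [hsum, g.sum_eq_one_of_subset hgs.subset]) (hθ i)
        refine Or.inl (Subtype.ext (funext fun a => ?_))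
        by_cases ha : a ∈ F i
        · have := congrFun heq ((b i).symm ⟨a, ha⟩)
          simpa [r] using this
        · have h1 : f.1 a = 0 := by
            by_contra h; exact ha (hfs.subset (Realization.mem_supp.2 h))
          have h2 : g.1 a = 0 := by
            by_contra h; exact ha (hgs.subset (Realization.mem_supp.2 h))
          rw [h1, h2]
    · rintro (rfl | ⟨hf, hg⟩)
      · rfl
      · rw [hq_coned f hf, hq_coned g hg]
  exact nonempty_homotopyEquiv_of_collapse (q := ⟨q, hqcont⟩)
    (hqcont.isClosedMap.isQuotientMap hqcont hsurj) hker hφ hφc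

end Wedge

section Covering

/-- The pair `(i, 0)` encodes the edge of the central path joining the vertices `i` and `i + 1`, and
`(i, l)` with `0 < l` the leg number `l` at the vertex `i`. -/
def Covers (p : ℕ × ℕ) (v : ℕ) : Prop := v = p.1 ∨ (p.2 = 0 ∧ v = p.1 + 1)

/-- The pair `p` encodes an edge of the perfect `m`-caterpillar of length `n`. -/
def IsCode (m n : ℕ) (p : ℕ × ℕ) : Prop := p.1 < n ∧ p.2 < m ∧ (p.2 = 0 → p.1 + 1 < n)

/-- A matching without legs of number zero which covers the central path. -/
structure IsCovering (m n : ℕ) (s : Finset (ℕ × ℕ)) : Prop where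
  isCode : ∀ p ∈ s, IsCode m n p
  unique : ∀ v, ∀ p ∈ s, ∀ q ∈ s, Covers p v → Covers q v → p = q
  exists_covers : ∀ v < n, ∃ p ∈ s, Covers p v

/-- All the matchings without legs of number zero which cover the central path. -/
def coverings (m : ℕ) : ℕ → Finset (Finset (ℕ × ℕ))
  | 0 => {∅}
  | 1 => (Finset.Ico 1 m).image fun l => {(0, l)}
  | n + 2 =>
    ((Finset.Ico 1 m ×ˢ coverings m (n + 1)).image fun q => insert (n + 1, q.1) q.2) ∪
      (coverings m n).image (insert (n, 0))

theorem covers_fst (p : ℕ × ℕ) : Covers p p.1 := Or.inl rfl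

theorem isCode_iff {m n : ℕ} {p : ℕ × ℕ} :
    IsCode m n p ↔ p.2 < m ∧ ∀ v, Covers p v → v < n := by
  constructor
  · rintro ⟨h1, h2, h3⟩
    refine ⟨h2, ?_⟩
    rintro v (rfl | ⟨h, rfl⟩)
    exacts [h1, h3 h]
  · rintro ⟨h1, h2⟩
    exact ⟨h2 _ (covers_fst p), h1, fun h => h2 _ (Or.inr ⟨h, rfl⟩)⟩

theorem IsCovering.lt {m n v : ℕ} {s : Finset (ℕ × ℕ)} (hs : IsCovering m n s) {p : ℕ × ℕ}
    (hp : p ∈ s) (hv : Covers p v) : v < n :=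
  (isCode_iff.1 (hs.isCode p hp)).2 v hv

theorem IsCovering.insert {m n N : ℕ} {s : Finset (ℕ × ℕ)} {p : ℕ × ℕ} (hs : IsCovering m n s)
    (hp : IsCode m N p) (hnN : n ≤ N) (hpv : ∀ v < N, Covers p v ↔ n ≤ v) :
    IsCovering m N (insert p s) := by
  have hdisj : ∀ v, ∀ q ∈ s, Covers p v → ¬ Covers q v := fun v q hq h1 h2 =>
    absurd (hs.lt hq h2) (not_lt.2 ((hpv v ((isCode_iff.1 hp).2 v h1)).1 h1))
  refine ⟨?_, ?_, ?_⟩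
  · intro q hq
    rcases Finset.mem_insert.1 hq with rfl | hq
    · exact hp
    · exact isCode_iff.2 ⟨(hs.isCode q hq).2.1, fun v hv => (hs.lt hq hv).trans_le hnN⟩
  · intro v q hq q' hq' h h'
    rcases Finset.mem_insert.1 hq with rfl | hqs <;> rcases Finset.mem_insert.1 hq' with rfl | hqs'
    · rfl
    · exact absurd h' (hdisj v _ hqs' h)
    · exact absurd h (hdisj v _ hqs h')
    · exact hs.unique v q hqs q' hqs' h h'
  · intro v hv
    by_cases h : n ≤ v
    · exact ⟨p, Finset.mem_insert_self _ _, (hpv v hv).2 h⟩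
    · obtain ⟨q, hq, hqv⟩ := hs.exists_covers v (not_le.1 h)
      exact ⟨q, Finset.mem_insert_of_mem hq, hqv⟩

theorem IsCovering.erase {m n N : ℕ} {s : Finset (ℕ × ℕ)} {p : ℕ × ℕ} (hs : IsCovering m N s)
    (hp : p ∈ s) (hnN : n ≤ N) (hpv : ∀ v < N, Covers p v ↔ n ≤ v) :
    IsCovering m n (s.erase p) := by
  refine ⟨?_, ?_, ?_⟩
  · intro q hq
    obtain ⟨hqp, hq⟩ := Finset.mem_erase.1 hq
    refine isCode_iff.2 ⟨(hs.isCode q hq).2.1, fun v hv => ?_⟩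
    by_contra h
    exact hqp (hs.unique v q hq p hp hv ((hpv v (hs.lt hq hv)).2 (not_lt.1 h)))
  · exact fun v q hq q' hq' =>
      hs.unique v q (Finset.mem_of_mem_erase hq) q' (Finset.mem_of_mem_erase hq')
  · intro v hv
    obtain ⟨q, hq, hqv⟩ := hs.exists_covers v (hv.trans_le hnN)
    refine ⟨q, Finset.mem_erase.2 ⟨?_, hq⟩, hqv⟩
    rintro rfl
    exact absurd hv (not_lt.2 ((hpv v (hv.trans_le hnN)).1 hqv))

theorem covers_leg_iff {n l : ℕ} (hl : l ≠ 0) : ∀ v < n + 1, Covers (n, l) v ↔ n ≤ v := by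
  intro v hv
  simp only [Covers, hl, false_and, or_false]
  omega

theorem covers_spine_iff {n : ℕ} : ∀ v < n + 2, Covers (n, 0) v ↔ n ≤ v := by
  intro v hv
  simp only [Covers, true_and]
  omega

theorem IsCovering.insert_leg {m n l : ℕ} {s : Finset (ℕ × ℕ)} (hs : IsCovering m n s)
    (hl : l ∈ Finset.Ico 1 m) : IsCovering m (n + 1) (Insert.insert (n, l) s) := by
  rw [Finset.mem_Ico] at hl
  exact hs.insert ⟨n.lt_succ_self, hl.2, fun h => by simp only at h; omega⟩ n.le_succ
    (covers_leg_iff (by omega))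

theorem IsCovering.insert_spine {m n : ℕ} {s : Finset (ℕ × ℕ)} (hm : 0 < m)
    (hs : IsCovering m n s) : IsCovering m (n + 2) (Insert.insert (n, 0) s) :=
  hs.insert ⟨by simp, hm, by simp⟩ (by omega) covers_spine_iff

theorem IsCovering.erase_leg {m n l : ℕ} {s : Finset (ℕ × ℕ)} (hs : IsCovering m (n + 1) s)
    (hl : (n, l) ∈ s) : l ∈ Finset.Ico 1 m ∧ IsCovering m n (s.erase (n, l)) := by
  obtain ⟨-, h1, h2⟩ := hs.isCode _ hl
  have h0 : l ≠ 0 := fun h => lt_irrefl _ (h2 h)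
  exact ⟨Finset.mem_Ico.2 ⟨Nat.one_le_iff_ne_zero.2 h0, h1⟩,
    hs.erase hl n.le_succ (covers_leg_iff h0)⟩

theorem IsCovering.erase_spine {m n : ℕ} {s : Finset (ℕ × ℕ)} (hs : IsCovering m (n + 2) s)
    (hl : (n, 0) ∈ s) : IsCovering m n (s.erase (n, 0)) :=
  hs.erase hl (by omega) covers_spine_iff

theorem isCovering_zero {m : ℕ} {s : Finset (ℕ × ℕ)} : IsCovering m 0 s ↔ s = ∅ := by
  constructor
  · intro hs
    exact Finset.eq_empty_of_forall_notMem fun p hp => absurd (hs.isCode p hp).1 (Nat.not_lt_zero _)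
  · rintro rfl
    exact ⟨by simp, by simp, by simp⟩

theorem mem_coverings {m : ℕ} (hm : 0 < m) :
    ∀ {n : ℕ} {s : Finset (ℕ × ℕ)}, s ∈ coverings m n ↔ IsCovering m n s
  | 0, s => by rw [isCovering_zero, coverings, Finset.mem_singleton]
  | 1, s => by
    simp only [coverings, Finset.mem_image]
    constructor
    · rintro ⟨l, hl, rfl⟩
      exact (isCovering_zero.2 rfl).insert_leg hl
    · intro hs
      obtain ⟨⟨i, l⟩, hp, -⟩ := hs.exists_covers 0 one_pos
      obtain rfl : i = 0 := Nat.lt_one_iff.1 (hs.isCode _ hp).1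
      obtain ⟨hl, he⟩ := hs.erase_leg hp
      refine ⟨l, hl, ?_⟩
      rw [← Finset.insert_erase hp, isCovering_zero.1 he]
      rfl
  | n + 2, s => by
    simp only [coverings, Finset.mem_union, Finset.mem_image, Finset.mem_product, Prod.exists]
    constructor
    · rintro (⟨l, t, ⟨hl, ht⟩, rfl⟩ | ⟨t, ht, rfl⟩)
      · exact ((mem_coverings hm).1 ht).insert_leg hl
      · exact ((mem_coverings hm).1 ht).insert_spine hm
    · intro hs
      obtain ⟨⟨i, l⟩, hp, rfl | ⟨h0, hi⟩⟩ := hs.exists_covers (n + 1) (by omega)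
      · obtain ⟨hl, he⟩ := hs.erase_leg hp
        exact Or.inl ⟨l, _, ⟨hl, (mem_coverings hm).2 he⟩, Finset.insert_erase hp⟩
      · obtain rfl : n = i := by simpa using hi
        obtain rfl : l = 0 := h0
        exact Or.inr ⟨_, (mem_coverings hm).2 (hs.erase_spine hp), Finset.insert_erase hp⟩

theorem IsCovering.notMem {m n i l : ℕ} {s : Finset (ℕ × ℕ)} (hs : IsCovering m n s) (hi : n ≤ i) :
    (i, l) ∉ s := fun h => absurd (hs.isCode _ h).1 (not_lt.2 hi)

theorem card_filter_coverings_add_two {m : ℕ} (hm : 0 < m) (n c : ℕ) :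
    ((coverings m (n + 2)).filter fun s => s.card = c + 1).card =
      (m - 1) * ((coverings m (n + 1)).filter fun s => s.card = c).card +
        ((coverings m n).filter fun s => s.card = c).card := by
  have h1 : ((Finset.Ico 1 m ×ˢ coverings m (n + 1)).image
      fun q => insert (n + 1, q.1) q.2).filter (fun s => s.card = c + 1) =
      (Finset.Ico 1 m ×ˢ (coverings m (n + 1)).filter fun s => s.card = c).image
        fun q => insert (n + 1, q.1) q.2 := by
    ext s
    simp only [Finset.mem_filter, Finset.mem_image, Finset.mem_product, Prod.exists]
    constructor
    · rintro ⟨⟨l, t, ⟨hl, ht⟩, rfl⟩, hc⟩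
      rw [Finset.card_insert_of_notMem (((mem_coverings hm).1 ht).notMem le_rfl)] at hc
      exact ⟨l, t, ⟨hl, ht, by omega⟩, rfl⟩
    · rintro ⟨l, t, ⟨hl, ht, hc⟩, rfl⟩
      refine ⟨⟨l, t, ⟨hl, ht⟩, rfl⟩, ?_⟩
      rw [Finset.card_insert_of_notMem (((mem_coverings hm).1 ht).notMem le_rfl), hc]
  have h2 : ((coverings m n).image (insert (n, 0))).filter (fun s => s.card = c + 1) =
      ((coverings m n).filter fun s => s.card = c).image (insert (n, 0)) := by
    ext s
    simp only [Finset.mem_filter, Finset.mem_image]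
    constructor
    · rintro ⟨⟨t, ht, rfl⟩, hc⟩
      rw [Finset.card_insert_of_notMem (((mem_coverings hm).1 ht).notMem le_rfl)] at hc
      exact ⟨t, ⟨ht, by omega⟩, rfl⟩
    · rintro ⟨t, ⟨ht, hc⟩, rfl⟩
      refine ⟨⟨t, ht, rfl⟩, ?_⟩
      rw [Finset.card_insert_of_notMem (((mem_coverings hm).1 ht).notMem le_rfl), hc]
  rw [coverings, Finset.filter_union, h1, h2, Finset.card_union_of_disjoint,
    Finset.card_image_of_injOn, Finset.card_image_of_injOn, Finset.card_product, Nat.card_Ico]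
  · intro s hs t ht hst
    rw [Finset.mem_coe, Finset.mem_filter, mem_coverings hm] at hs ht
    have := congrArg (Finset.erase · (n, 0)) hst
    simpa [Finset.erase_insert (hs.1.notMem le_rfl), Finset.erase_insert (ht.1.notMem le_rfl)]
      using this
  · rintro ⟨l, s⟩ hs ⟨l', t⟩ ht hst
    rw [Finset.mem_coe, Finset.mem_product, Finset.mem_filter, mem_coverings hm] at hs ht
    have hst : insert (n + 1, l) s = insert (n + 1, l') t := hst
    have hl : l = l' := by
      have h := hst ▸ Finset.mem_insert_self (n + 1, l) s
      rcases Finset.mem_insert.1 h with h | h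
      · exact (Prod.ext_iff.1 h).2
      · exact absurd h (ht.2.1.notMem le_rfl)
    subst hl
    have := congrArg (Finset.erase · (n + 1, l)) hst
    simp only [Finset.erase_insert (hs.2.1.notMem le_rfl),
      Finset.erase_insert (ht.2.1.notMem le_rfl)] at this
    rw [this]
  · rw [Finset.disjoint_left]
    intro s hs ht
    simp only [Finset.mem_image, Finset.mem_product, Finset.mem_filter, Prod.exists,
      mem_coverings hm] at hs ht
    obtain ⟨l, s, ⟨-, hs, -⟩, rfl⟩ := hs
    obtain ⟨t, ⟨ht, -⟩, h⟩ := ht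
    have h' := h ▸ Finset.mem_insert_self (n + 1, l) s
    rcases Finset.mem_insert.1 h' with h' | h'
    · simp at h'
    · exact ht.notMem (Nat.le_succ n) h'

theorem card_filter_coverings {m : ℕ} (hm : 0 < m) : ∀ n c : ℕ,
    ((coverings m n).filter fun s => s.card = c).card =
      if n ≤ 2 * c ∧ c ≤ n then c.choose (n - c) * (m - 1) ^ (2 * c - n) else 0
  | 0, c => by
    rcases c with _ | c <;> simp [coverings, Finset.filter_singleton]
  | 1, c => by
    rw [coverings, Finset.filter_image]
    simp only [Finset.card_singleton]
    by_cases h : 1 = c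
    · subst h
      simp only [Finset.filter_true]
      rw [Finset.card_image_of_injective _ fun a b h => by simpa using h]
      simp
    · rw [if_neg (by omega)]
      simp [h]
  | n + 2, 0 => by
    rw [if_neg (by omega), Finset.card_eq_zero, Finset.filter_eq_empty_iff]
    intro s hs hc
    obtain ⟨p, hp, -⟩ := ((mem_coverings hm).1 hs).exists_covers 0 (by omega)
    exact absurd hc (Finset.card_pos.2 ⟨p, hp⟩).ne'
  | n + 2, c + 1 => by
    rw [card_filter_coverings_add_two hm, card_filter_coverings hm (n + 1) c,
      card_filter_coverings hm n c]
    by_cases h : n ≤ 2 * c ∧ c ≤ n + 1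
    · obtain ⟨h1, h2⟩ := h
      rw [if_pos (show n + 2 ≤ 2 * (c + 1) ∧ c + 1 ≤ n + 2 by omega)]
      rcases h2.eq_or_lt with rfl | h2
      · rw [if_pos (by omega), if_neg (by omega), show n + 2 - (n + 1 + 1) = 0 by omega,
          show n + 1 - (n + 1) = 0 by omega, show 2 * (n + 1 + 1) - (n + 2) = n + 2 by omega,
          show 2 * (n + 1) - (n + 1) = n + 1 by omega]
        simp only [Nat.choose_zero_right]
        ring
      · rw [if_pos (show n ≤ 2 * c ∧ c ≤ n by omega),
          show n + 2 - (c + 1) = (n - c) + 1 by omega, Nat.choose_succ_succ,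
          show 2 * (c + 1) - (n + 2) = 2 * c - n by omega]
        rcases h1.eq_or_lt with h1 | h1
        · rw [if_neg (by omega), Nat.choose_eq_zero_of_lt (show c < n - c + 1 by omega)]
          simp
        · rw [if_pos (by omega), show 2 * c - n = 2 * c - (n + 1) + 1 by omega,
            show n + 1 - c = n - c + 1 by omega]
          ring
    · rw [if_neg (by omega), if_neg (by omega), if_neg (by omega), mul_zero]

end Covering

/-- A finite set graded by a size function can be enumerated by its graded pieces. -/
theorem exists_graded_enumeration {β : Type*} (T : Finset β) (size : β → ℕ) (k b : ℕ) (A : ℕ → ℕ)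
    (hA : ∀ t ≤ k, (T.filter fun x => size x = b + t).card = A t)
    (hT : ∀ x ∈ T, b ≤ size x ∧ size x ≤ b + k) :
    ∃ F : (Σ t : Fin (k + 1), Fin (A t)) → β, Function.Injective F ∧
      (∀ p, F p ∈ T ∧ size (F p) = b + p.1) ∧ ∀ x ∈ T, ∃ p, F p = x := by
  let e : ∀ t : Fin (k + 1), (T.filter fun x => size x = b + t) ≃ Fin (A t) := fun t =>
    Finset.equivFinOfCardEq (hA t (Nat.lt_succ_iff.1 t.2))
  have hmem : ∀ p : Σ t : Fin (k + 1), Fin (A t),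
      ((e p.1).symm p.2 : β) ∈ T ∧ size ((e p.1).symm p.2) = b + p.1 := fun p =>
    Finset.mem_filter.1 ((e p.1).symm p.2).2
  refine ⟨fun p => (e p.1).symm p.2, ?_, hmem, ?_⟩
  · rintro ⟨t, i⟩ ⟨t', i'⟩ h
    have h1 := (hmem ⟨t, i⟩).2
    have h2 := (hmem ⟨t', i'⟩).2
    simp only at h h1 h2
    obtain rfl : t = t' := Fin.ext (by rw [h] at h1; omega)
    rw [(e t).symm.injective (Subtype.ext h)]
  · intro x hx
    obtain ⟨h1, h2⟩ := hT x hx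
    refine ⟨⟨⟨size x - b, by omega⟩, e _ ⟨x, Finset.mem_filter.2 ⟨hx, ?_⟩⟩⟩, ?_⟩
    · simp only; omega
    · simp

section Caterpillar

variable {m n : ℕ}

theorem mem_edgeSet_caterpillar {e : Sym2 (Fin n ⊕ Σ _ : Fin n, Fin m)} :
    e ∈ (caterpillar n fun _ => m).edgeSet ↔
      (∃ i j : Fin n, (i : ℕ) + 1 = j ∧ e = s(Sum.inl i, Sum.inl j)) ∨
        ∃ (i : Fin n) (l : Fin m), e = s(Sum.inl i, Sum.inr ⟨i, l⟩) := by
  constructor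
  · induction e using Sym2.ind with | _ x y
    rw [SimpleGraph.mem_edgeSet, caterpillar, SimpleGraph.fromRel_adj]
    rintro ⟨-, h⟩
    rcases x with i | ⟨i, l⟩ <;> rcases y with j | ⟨j, l'⟩ <;> simp only [or_false, false_or] at h
    · rcases h with h | h
      · exact Or.inl ⟨i, j, h, rfl⟩
      · exact Or.inl ⟨j, i, h, Sym2.eq_swap⟩
    · subst h
      exact Or.inr ⟨i, l', rfl⟩
    · subst h
      exact Or.inr ⟨j, l, Sym2.eq_swap⟩
  · rintro (⟨i, j, h, rfl⟩ | ⟨i, l, rfl⟩)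
    · rw [SimpleGraph.mem_edgeSet, caterpillar, SimpleGraph.fromRel_adj]
      refine ⟨fun hij => ?_, Or.inl h⟩
      rw [Sum.inl.injEq] at hij
      subst hij
      omega
    · rw [SimpleGraph.mem_edgeSet, caterpillar, SimpleGraph.fromRel_adj]
      exact ⟨Sum.inl_ne_inr, Or.inl rfl⟩

/-- Incident edges of a caterpillar meet on the central path. -/
theorem exists_inl_mem_of_edgeIncident {e f : Sym2 (Fin n ⊕ Σ _ : Fin n, Fin m)}
    (he : e ∈ (caterpillar n fun _ => m).edgeSet) (hf : f ∈ (caterpillar n fun _ => m).edgeSet)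
    (h : EdgeIncident e f) : ∃ j, Sum.inl j ∈ e ∧ Sum.inl j ∈ f := by
  obtain ⟨j | x, h1, h2⟩ := h
  · exact ⟨j, h1, h2⟩
  · have key : ∀ e ∈ (caterpillar n fun _ => m).edgeSet, Sum.inr x ∈ e → Sum.inl x.1 ∈ e := by
      intro e he hx
      rcases mem_edgeSet_caterpillar.1 he with ⟨i, j, -, rfl⟩ | ⟨i, l, rfl⟩
      · simp at hx
      · simp only [Sym2.mem_iff, reduceCtorEq, Sum.inr.injEq, false_or] at hx
        subst hx
        exact Sym2.mem_mk_left _ _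
    exact ⟨x.1, key e he h1, key f hf h2⟩

theorem mem_matchingComplex_caterpillar {s : Finset (Sym2 (Fin n ⊕ Σ _ : Fin n, Fin m))} :
    s ∈ matchingComplex (caterpillar n fun _ => m) ↔
      (∀ e ∈ s, e ∈ (caterpillar n fun _ => m).edgeSet) ∧
        ∀ j, ∀ e ∈ s, ∀ f ∈ s, Sum.inl j ∈ e → Sum.inl j ∈ f → e = f := by
  refine and_congr_right fun hs => ⟨fun h j e he f hf hje hjf => ?_, fun h e he f hf hne hi => ?_⟩
  · by_contra hne
    exact h he hf hne ⟨_, hje, hjf⟩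
  · obtain ⟨j, hje, hjf⟩ := exists_inl_mem_of_edgeIncident (hs e he) (hs f hf) hi
    exact hne (h j e he f hf hje hjf)

variable [NeZero m]

/-- The leg number zero at a vertex of the central path. -/
def firstLeg (j : Fin n) : Sym2 (Fin n ⊕ Σ _ : Fin n, Fin m) := s(Sum.inl j, Sum.inr ⟨j, 0⟩)

theorem inl_mem_firstLeg {i j : Fin n} : Sum.inl i ∈ firstLeg (m := m) j ↔ i = j := by
  simp [firstLeg]

theorem firstLeg_mem_edgeSet (j : Fin n) :
    firstLeg (m := m) j ∈ (caterpillar n fun _ => m).edgeSet :=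
  mem_edgeSet_caterpillar.2 (Or.inr ⟨j, 0, rfl⟩)

open Classical in
/-- The edges at a vertex of the central path other than its leg number zero. -/
noncomputable def otherEdges (j : Fin n) : Finset (Sym2 (Fin n ⊕ Σ _ : Fin n, Fin m)) :=
  Finset.univ.filter fun e => Sum.inl j ∈ e ∧ e ≠ firstLeg j

theorem mem_otherEdges {j : Fin n} {e : Sym2 (Fin n ⊕ Σ _ : Fin n, Fin m)} :
    e ∈ otherEdges j ↔ Sum.inl j ∈ e ∧ e ≠ firstLeg j := by
  simp [otherEdges]

theorem coneFamily_caterpillar :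
    ConeFamily (matchingComplex (caterpillar n fun _ => m)) firstLeg otherEdges where
  down s hs t hts := by
    rw [mem_matchingComplex_caterpillar] at hs ⊢
    exact ⟨fun e he => hs.1 e (hts he), fun j e he f hf => hs.2 j e (hts he) f (hts hf)⟩
  empty_mem := mem_matchingComplex_caterpillar.2 ⟨by simp, by simp⟩
  cone s hs J hJ := by
    rw [mem_matchingComplex_caterpillar] at hs ⊢
    have key : ∀ j ∈ J, ∀ i, ∀ e ∈ s, Sum.inl i ∈ e → Sum.inl i ∈ firstLeg (m := m) j →
        e = firstLeg j := by
      intro j hj i e he hie hij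
      rw [inl_mem_firstLeg] at hij
      subst hij
      by_contra hne
      exact Finset.disjoint_left.1 (hJ i hj) he (mem_otherEdges.2 ⟨hie, hne⟩)
    refine ⟨fun e he => ?_, fun i e he f hf hie hif => ?_⟩
    · rcases Finset.mem_union.1 he with he | he
      · exact hs.1 e he
      · obtain ⟨j, -, rfl⟩ := Finset.mem_image.1 he
        exact firstLeg_mem_edgeSet j
    · rcases Finset.mem_union.1 he with he | he <;> rcases Finset.mem_union.1 hf with hf | hf
      · exact hs.2 i e he f hf hie hif
      · obtain ⟨j, hj, rfl⟩ := Finset.mem_image.1 hf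
        exact key j hj i e he hie hif
      · obtain ⟨j, hj, rfl⟩ := Finset.mem_image.1 he
        exact (key j hj i f hf hif hie).symm
      · obtain ⟨j, -, rfl⟩ := Finset.mem_image.1 he
        obtain ⟨j', -, rfl⟩ := Finset.mem_image.1 hf
        rw [inl_mem_firstLeg] at hie hif
        rw [← hie, ← hif]
  avoid j k hk := by
    obtain ⟨h1, h2⟩ := mem_otherEdges.1 hk
    exact h2 (by rw [inl_mem_firstLeg.1 h1])

variable [NeZero n]

/-- The edge encoded by a pair of natural numbers. -/
def edgeOf (p : ℕ × ℕ) : Sym2 (Fin n ⊕ Σ _ : Fin n, Fin m) :=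
  if p.2 = 0 then s(Sum.inl (Fin.ofNat n p.1), Sum.inl (Fin.ofNat n (p.1 + 1)))
  else s(Sum.inl (Fin.ofNat n p.1), Sum.inr ⟨Fin.ofNat n p.1, Fin.ofNat m p.2⟩)

theorem fin_eq_ofNat_iff {k i : ℕ} [NeZero k] (hi : i < k) {j : Fin k} :
    j = Fin.ofNat k i ↔ (j : ℕ) = i := by
  rw [Fin.ext_iff, Fin.val_ofNat, Nat.mod_eq_of_lt hi]

theorem edgeOf_mem_edgeSet {p : ℕ × ℕ} (hp : IsCode m n p) :
    edgeOf p ∈ (caterpillar n fun _ => m).edgeSet := by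
  obtain ⟨h1, h2, h3⟩ := hp
  rw [edgeOf]
  split_ifs with h
  · refine mem_edgeSet_caterpillar.2 (Or.inl ⟨_, _, ?_, rfl⟩)
    rw [(fin_eq_ofNat_iff h1).1 rfl, (fin_eq_ofNat_iff (h3 h)).1 rfl]
  · exact mem_edgeSet_caterpillar.2 (Or.inr ⟨_, _, rfl⟩)

theorem inl_mem_edgeOf {p : ℕ × ℕ} (hp : IsCode m n p) {j : Fin n} :
    Sum.inl j ∈ edgeOf (m := m) p ↔ Covers p j := by
  obtain ⟨h1, h2, h3⟩ := hp
  rw [edgeOf, Covers]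
  split_ifs with h
  · simp only [Sym2.mem_iff, Sum.inl.injEq, fin_eq_ofNat_iff h1, fin_eq_ofNat_iff (h3 h), h,
      true_and]
  · simp only [Sym2.mem_iff, Sum.inl.injEq, reduceCtorEq, fin_eq_ofNat_iff h1, h, false_and]

theorem edgeOf_ne_firstLeg {p : ℕ × ℕ} (hp : IsCode m n p) (j : Fin n) :
    edgeOf (m := m) p ≠ firstLeg j := by
  intro he
  have : (Sum.inr ⟨j, 0⟩ : Fin n ⊕ Σ _ : Fin n, Fin m) ∈ edgeOf (m := m) p :=
    he ▸ Sym2.mem_mk_right _ _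
  rw [edgeOf] at this
  split_ifs at this with h
  · simp at this
  · simp only [Sym2.mem_iff, reduceCtorEq, Sum.inr.injEq, false_or, Sigma.mk.injEq,
      heq_eq_eq, fin_eq_ofNat_iff hp.2.1] at this
    exact h (by simpa using this.2.symm)

theorem edgeOf_injOn : Set.InjOn (edgeOf (m := m) (n := n)) {p | IsCode m n p} := by
  rintro ⟨i, l⟩ hp ⟨i', l'⟩ hq h
  have hp' := hp
  have hq' := hq
  obtain ⟨h1, h2, h3⟩ := hp
  obtain ⟨h1', h2', h3'⟩ := hq
  simp only at h1 h2 h3 h1' h2' h3'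
  have hc : ∀ v : Fin n, Covers (i, l) v ↔ Covers (i', l') v := fun v => by
    rw [← inl_mem_edgeOf hp', ← inl_mem_edgeOf hq', h]
  by_cases hl : l = 0 <;> by_cases hl' : l' = 0
  · have a := hc ⟨i, h1⟩
    have b := hc ⟨i', h1'⟩
    simp only [Covers, hl, hl', true_and, true_or, iff_true, true_iff] at a b
    rw [Prod.mk.injEq]
    omega
  · simp [edgeOf, hl, hl'] at h
  · simp [edgeOf, hl, hl'] at h
  · have a := hc ⟨i, h1⟩
    have : (Sum.inr ⟨Fin.ofNat n i, Fin.ofNat m l⟩ : Fin n ⊕ Σ _ : Fin n, Fin m) ∈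
        edgeOf (m := m) (n := n) (i', l') := by
      rw [← h]; simp [edgeOf, hl]
    simp only [edgeOf, hl', if_false, Sym2.mem_iff, reduceCtorEq, Sum.inr.injEq, false_or,
      Sigma.mk.injEq, heq_eq_eq, fin_eq_ofNat_iff h2', fin_eq_ofNat_iff h1'] at this
    rw [Prod.mk.injEq, ← this.1, ← this.2]
    exact ⟨((fin_eq_ofNat_iff h1).1 rfl).symm, ((fin_eq_ofNat_iff h2).1 rfl).symm⟩

theorem exists_edgeOf_eq {e : Sym2 (Fin n ⊕ Σ _ : Fin n, Fin m)}
    (he : e ∈ (caterpillar n fun _ => m).edgeSet) (hne : ∀ j, e ≠ firstLeg j) :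
    ∃ p, IsCode m n p ∧ edgeOf p = e := by
  rcases mem_edgeSet_caterpillar.1 he with ⟨i, j, hij, rfl⟩ | ⟨i, l, rfl⟩
  · refine ⟨(i, 0), ⟨i.2, NeZero.pos m, fun _ => ?_⟩, ?_⟩
    · simp only; omega
    · simp [edgeOf, hij]
  · have hl : (l : ℕ) ≠ 0 := fun h => by
      obtain rfl : l = 0 := Fin.ext (by simpa using h)
      exact hne i rfl
    refine ⟨(i, l), ⟨i.2, l.2, fun h => absurd h hl⟩, ?_⟩
    simp [edgeOf, hl]

open Classical in
theorem IsCovering.image_mem {t : Finset (ℕ × ℕ)} (ht : IsCovering m n t) :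
    t.image edgeOf ∈ matchingComplex (caterpillar n fun _ => m) := by
  refine mem_matchingComplex_caterpillar.2 ⟨fun e he => ?_, fun j e he f hf hje hjf => ?_⟩
  · obtain ⟨p, hp, rfl⟩ := Finset.mem_image.1 he
    exact edgeOf_mem_edgeSet (ht.isCode p hp)
  · obtain ⟨p, hp, rfl⟩ := Finset.mem_image.1 he
    obtain ⟨q, hq, rfl⟩ := Finset.mem_image.1 hf
    rw [inl_mem_edgeOf (ht.isCode _ ‹_›)] at hje hjf
    rw [ht.unique j p hp q hq hje hjf]

open Classical in
theorem IsCovering.not_disjoint_image {t : Finset (ℕ × ℕ)} (ht : IsCovering m n t) (j : Fin n) :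
    ¬ Disjoint (t.image edgeOf) (otherEdges (m := m) j) := by
  obtain ⟨p, hp, hpj⟩ := ht.exists_covers j j.2
  exact Finset.not_disjoint_iff.2 ⟨_, Finset.mem_image_of_mem _ hp, mem_otherEdges.2
    ⟨(inl_mem_edgeOf (ht.isCode p hp)).2 hpj, edgeOf_ne_firstLeg (ht.isCode p hp) j⟩⟩

open Classical in
theorem IsCovering.card_image {t : Finset (ℕ × ℕ)} (ht : IsCovering m n t) :
    (t.image (edgeOf (m := m) (n := n))).card = t.card :=
  Finset.card_image_of_injOn fun _ hp _ hq h => edgeOf_injOn (ht.isCode _ hp) (ht.isCode _ hq) h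

open Classical in
theorem IsCovering.eq_of_image_subset {t t' : Finset (ℕ × ℕ)} (ht : IsCovering m n t)
    (ht' : IsCovering m n t')
    (h : t.image (edgeOf (m := m) (n := n)) ⊆ t'.image edgeOf) : t = t' := by
  have hsub : t ⊆ t' := by
    intro p hp
    obtain ⟨q, hq, hqp⟩ := Finset.mem_image.1 (h (Finset.mem_image_of_mem _ hp))
    rwa [← edgeOf_injOn (ht'.isCode q hq) (ht.isCode p hp) hqp]
  refine hsub.antisymm fun q hq => ?_
  obtain ⟨p, hp, hpq⟩ := ht.exists_covers q.1 (ht'.isCode q hq).1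
  rwa [ht'.unique _ q hq p (hsub hp) (covers_fst q) hpq]

open Classical in
theorem exists_isCovering_image_eq {s : Finset (Sym2 (Fin n ⊕ Σ _ : Fin n, Fin m))}
    (hs : s ∈ matchingComplex (caterpillar n fun _ => m))
    (hs' : ∀ j, ¬ Disjoint s (otherEdges j)) : ∃ t, IsCovering m n t ∧ t.image edgeOf = s := by
  rw [mem_matchingComplex_caterpillar] at hs
  let t := (Finset.range n ×ˢ Finset.range m).filter fun p => IsCode m n p ∧ edgeOf p ∈ s
  have ht : ∀ p, p ∈ t ↔ IsCode m n p ∧ edgeOf p ∈ s := by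
    intro p
    simp only [t, Finset.mem_filter, Finset.mem_product, Finset.mem_range, and_iff_right_iff_imp]
    exact fun h => ⟨h.1.1, h.1.2.1⟩
  have hfirst : ∀ e ∈ s, ∀ j, e ≠ firstLeg j := by
    rintro e he j rfl
    obtain ⟨f, hf, hfj⟩ := Finset.not_disjoint_iff.1 (hs' j)
    rw [mem_otherEdges] at hfj
    exact hfj.2 (hs.2 j f hf _ he hfj.1 (inl_mem_firstLeg.2 rfl))
  have hex : ∀ e ∈ s, ∃ p ∈ t, edgeOf p = e := by
    intro e he
    obtain ⟨p, hp, rfl⟩ := exists_edgeOf_eq (hs.1 e he) (hfirst e he)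
    exact ⟨p, (ht p).2 ⟨hp, he⟩, rfl⟩
  refine ⟨t, ⟨fun p hp => ((ht p).1 hp).1, fun v p hp q hq hpv hqv => ?_, fun v hv => ?_⟩, ?_⟩
  · obtain ⟨hp, hps⟩ := (ht p).1 hp
    obtain ⟨hq, hqs⟩ := (ht q).1 hq
    have hv := (isCode_iff.1 hp).2 v hpv
    exact edgeOf_injOn hp hq (hs.2 ⟨v, hv⟩ _ hps _ hqs ((inl_mem_edgeOf hp).2 hpv)
      ((inl_mem_edgeOf hq).2 hqv))
  · obtain ⟨f, hf, hfj⟩ := Finset.not_disjoint_iff.1 (hs' ⟨v, hv⟩)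
    obtain ⟨p, hp, rfl⟩ := hex f hf
    exact ⟨p, hp, (inl_mem_edgeOf ((ht p).1 hp).1).1 (mem_otherEdges.1 hfj).1⟩
  · ext e
    rw [Finset.mem_image]
    refine ⟨?_, hex e⟩
    rintro ⟨p, hp, rfl⟩
    exact ((ht p).1 hp).2

/-- The matching complex of a perfect caterpillar is a wedge of spheres, one for each covering. -/
theorem nonempty_homotopyEquiv_of_coverings {ι : Type*} [Finite ι] (F : ι → Finset (ℕ × ℕ))
    (d : ι → ℕ) (hinj : Function.Injective F)
    (hF : ∀ i, F i ∈ coverings m n ∧ (F i).card = d i + 1)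
    (hsurj : ∀ s ∈ coverings m n, ∃ i, F i = s) :
    Nonempty (ContinuousMap.HomotopyEquiv
      (Realization (matchingComplex (caterpillar n fun _ => m))) (WedgeOfSpheres d)) := by
  classical
  have hm := NeZero.pos m
  have hc : ∀ i, IsCovering m n (F i) := fun i => (mem_coverings hm).1 (hF i).1
  refine coneFamily_caterpillar.nonempty_homotopyEquiv_wedge (fun i => (F i).image edgeOf) d
    (fun i => (hc i).card_image.trans (hF i).2) (fun i => (hc i).image_mem)
    (fun i j => (hc i).not_disjoint_image j)
    (fun i i' h => hinj ((hc i).eq_of_image_subset (hc i') h)) fun s hs hs' => ?_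
  obtain ⟨t, ht, rfl⟩ := exists_isCovering_image_eq hs hs'
  obtain ⟨i, rfl⟩ := hsurj t ((mem_coverings hm).2 ht)
  exact ⟨i, rfl⟩

/-- The matching complex of a perfect caterpillar, when the coverings of each size are counted. -/
theorem nonempty_homotopyEquiv_of_card (k b : ℕ) (A : ℕ → ℕ)
    (d : (Σ t : Fin (k + 1), Fin (A t)) → ℕ)
    (hd : ∀ p, d p + 1 = b + p.1)
    (hA : ∀ t ≤ k, ((coverings m n).filter fun s => s.card = b + t).card = A t)
    (hn : n ≤ 2 * b) (hn' : 2 * b ≤ n + 1) (hb : b + k = n) :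
    Nonempty (ContinuousMap.HomotopyEquiv
      (Realization (matchingComplex (caterpillar n fun _ => m))) (WedgeOfSpheres d)) := by
  obtain ⟨F, hinj, hF, hsurj⟩ := exists_graded_enumeration (coverings m n) Finset.card k b A hA
    fun s hs => by
      have h := card_filter_coverings (NeZero.pos m) n s.card
      have hpos : 0 < ((coverings m n).filter fun t => t.card = s.card).card :=
        Finset.card_pos.2 ⟨s, Finset.mem_filter.2 ⟨hs, rfl⟩⟩
      by_cases hc : n ≤ 2 * s.card ∧ s.card ≤ n
      · omega
      · rw [if_neg hc] at h
        omega
  exact nonempty_homotopyEquiv_of_coverings F d hinj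
    (fun p => ⟨(hF p).1, (hF p).2.trans (hd p).symm⟩) hsurj

end Caterpillar

/-- Homotopy type of the matching complex of the perfect
`m`-caterpillar of length `n` (each path vertex has exactly `m ≥ 2` legs):
for `n = 2k` it is a wedge of `C(k+t, k−t)·(m−1)^{2t}` spheres `S^{k−1+t}`
over `t = 0, …, k`; for `n = 2k+1` a wedge of `C(k+1+t, k−t)·(m−1)^{2t+1}`
spheres `S^{k+t}` over `t = 0, …, k`. -/
theorem matchingComplex_perfect_caterpillar (m n : ℕ) (hm : 2 ≤ m) (hn : 1 ≤ n) :
    (∀ k : ℕ, n = 2 * k →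
      Nonempty
        (ContinuousMap.HomotopyEquiv
          (Realization (matchingComplex (caterpillar n fun _ => m)))
          (WedgeOfSpheres
            (fun p : Σ t : Fin (k + 1),
                Fin ((k + (t : ℕ)).choose (k - (t : ℕ)) * (m - 1) ^ (2 * (t : ℕ))) =>
              k - 1 + (p.1 : ℕ))))) ∧
    (∀ k : ℕ, n = 2 * k + 1 →
      Nonempty
        (ContinuousMap.HomotopyEquiv
          (Realization (matchingComplex (caterpillar n fun _ => m)))
          (WedgeOfSpheres
            (fun p : Σ t : Fin (k + 1),
                Fin ((k + 1 + (t : ℕ)).choose (k - (t : ℕ)) *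
                  (m - 1) ^ (2 * (t : ℕ) + 1)) =>
              k + (p.1 : ℕ))))) := by
  have : NeZero m := ⟨by omega⟩
  have : NeZero n := ⟨by omega⟩
  have hm0 : 0 < m := NeZero.pos m
  refine ⟨fun k hk => ?_, fun k hk => ?_⟩
  · refine nonempty_homotopyEquiv_of_card k k
      (fun t => (k + t).choose (k - t) * (m - 1) ^ (2 * t)) _ (fun p => by omega)
      (fun t ht => ?_) (by omega) (by omega) (by omega)
    rw [card_filter_coverings hm0, if_pos (by omega), show n - (k + t) = k - t by omega,
      show 2 * (k + t) - n = 2 * t by omega]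
  · refine nonempty_homotopyEquiv_of_card k (k + 1)
      (fun t => (k + 1 + t).choose (k - t) * (m - 1) ^ (2 * t + 1)) _ (fun p => by omega)
      (fun t ht => ?_) (by omega) (by omega) (by omega)
    rw [card_filter_coverings hm0, if_pos (by omega), show n - (k + 1 + t) = k - t by omega,
      show 2 * (k + 1 + t) - n = 2 * t + 1 by omega]
end

section
/- For natural numbers n and x with n ≡ x (mod 2) and x ≤ n, let A_x^n denote the set of strictly increasing sequences 1 ≤ i₁ < i₂ < ⋯ < i_x ≤ n of positions in [n] = {1, …, n} such that after marking the x selected positions, the remaining n − x positions can be partitioned into (n−x)/2 disjoint blocks of two consecutive positions. Then |A_x^n| = C((n+x)/2, (n−x)/2). -/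
/-- A finite set of naturals can be covered by disjoint 2-blocks: it is a disjoint
union of blocks `{j, j+1}` of two consecutive positions. -/
def Pairable (S : Finset ℕ) : Prop :=
  ∃ P : Finset ℕ, (∀ j ∈ P, ∀ l ∈ P, j ≠ l → j + 2 ≤ l ∨ l + 2 ≤ j) ∧
    S = P.biUnion fun j => {j, j + 1}

open scoped Classical in
/-- `A_x^n`: the `x`-element subsets of `[n] = {1, …, n}` whose complement in `[n]`
can be partitioned into `(n−x)/2` disjoint 2-blocks. -/
noncomputable def markedSets (n x : ℕ) : Finset (Finset ℕ) :=
  (Finset.Icc 1 n).powerset.filter fun s =>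
    s.card = x ∧ Pairable (Finset.Icc 1 n \ s)

theorem mem_markedSets {n x : ℕ} {s : Finset ℕ} :
    s ∈ markedSets n x ↔
      s ⊆ Finset.Icc 1 n ∧ s.card = x ∧ Pairable (Finset.Icc 1 n \ s) := by
  simp [markedSets]

theorem pairable_empty : Pairable ∅ := ⟨∅, by simp⟩

/-- If the largest element of `S` is `m + 1`, every pairing of `S` uses the block `{m, m + 1}`. -/
theorem pairable_iff_of_max {S : Finset ℕ} {m : ℕ} (hmem : m + 1 ∈ S)
    (hmax : ∀ a ∈ S, a ≤ m + 1) :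
    Pairable S ↔ m ∈ S ∧ Pairable (S \ {m, m + 1}) := by
  constructor
  · rintro ⟨P, hP, rfl⟩
    have hbd : ∀ j ∈ P, j ≤ m := fun j hj => by
      have := hmax (j + 1) (Finset.mem_biUnion.2 ⟨j, hj, by simp⟩)
      omega
    have hm : m ∈ P := by
      obtain ⟨j, hj, hmj⟩ := Finset.mem_biUnion.1 hmem
      have := hbd j hj
      simp only [Finset.mem_insert, Finset.mem_singleton] at hmj
      obtain rfl : j = m := by omega
      exact hj
    refine ⟨Finset.mem_biUnion.2 ⟨m, hm, by simp⟩, P.erase m, fun j hj l hl =>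
      hP j (Finset.mem_of_mem_erase hj) l (Finset.mem_of_mem_erase hl), ?_⟩
    ext a
    simp only [Finset.mem_sdiff, Finset.mem_biUnion, Finset.mem_insert, Finset.mem_singleton,
      Finset.mem_erase]
    constructor
    · rintro ⟨⟨j, hj, ha⟩, hne⟩
      exact ⟨j, ⟨by rintro rfl; exact hne ha, hj⟩, ha⟩
    · rintro ⟨j, ⟨hjm, hj⟩, ha⟩
      have := hP j hj m hm hjm
      have := hbd j hj
      exact ⟨⟨j, hj, ha⟩, by omega⟩
  · rintro ⟨hm, P, hP, hS⟩
    have hbd : ∀ j ∈ P, j + 2 ≤ m := fun j hj => by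
      have h : j + 1 ∈ S \ {m, m + 1} := by
        rw [hS]
        exact Finset.mem_biUnion.2 ⟨j, hj, by simp⟩
      simp only [Finset.mem_sdiff, Finset.mem_insert, Finset.mem_singleton] at h
      have := hmax _ h.1
      omega
    refine ⟨insert m P, ?_, ?_⟩
    · simp only [Finset.mem_insert]
      rintro j (rfl | hj) l (rfl | hl) hne
      · exact absurd rfl hne
      · exact Or.inr (hbd l hl)
      · exact Or.inl (hbd j hj)
      · exact hP j hj l hl hne
    · rw [Finset.biUnion_insert, ← hS, Finset.union_sdiff_of_subset]
      simp [Finset.insert_subset_iff, hm, hmem]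

theorem mem_markedSets_add_two_iff_of_notMem {n x : ℕ} {s : Finset ℕ} (hs : n + 2 ∉ s) :
    s ∈ markedSets (n + 2) x ↔ s ∈ markedSets n x := by
  have hpair : Pairable (Finset.Icc 1 (n + 2) \ s) ↔
      n + 1 ∉ s ∧ Pairable (Finset.Icc 1 n \ s) := by
    have hdiff : (Finset.Icc 1 (n + 2) \ s) \ {n + 1, n + 2} = Finset.Icc 1 n \ s := by
      ext a
      simp only [Finset.mem_sdiff, Finset.mem_Icc, Finset.mem_insert, Finset.mem_singleton]
      grind
    rw [pairable_iff_of_max (m := n + 1) (by simp [hs])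
      (fun a ha => (Finset.mem_Icc.1 (Finset.mem_sdiff.1 ha).1).2), hdiff]
    simp
  have hsub : s ⊆ Finset.Icc 1 n ↔ s ⊆ Finset.Icc 1 (n + 2) ∧ n + 1 ∉ s := by
    simp only [Finset.subset_iff, Finset.mem_Icc]
    constructor
    · intro h
      exact ⟨fun a ha => by have := h ha; omega, fun ha => by have := h ha; omega⟩
    · rintro ⟨h, h'⟩ a ha
      have := h ha
      have : a ≠ n + 1 := by rintro rfl; exact h' ha
      have : a ≠ n + 2 := by rintro rfl; exact hs ha
      omega
  rw [mem_markedSets, mem_markedSets, hpair, hsub]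
  tauto

theorem notMem_of_mem_markedSets {n x a : ℕ} {s : Finset ℕ} (hs : s ∈ markedSets n x)
    (ha : n < a) : a ∉ s := fun h => by
  have := Finset.mem_Icc.1 ((mem_markedSets.1 hs).1 h)
  omega

theorem insert_mem_markedSets_succ_iff {n x : ℕ} {s : Finset ℕ} (hs : n + 1 ∉ s) :
    insert (n + 1) s ∈ markedSets (n + 1) (x + 1) ↔ s ∈ markedSets n x := by
  have hdiff : Finset.Icc 1 (n + 1) \ insert (n + 1) s = Finset.Icc 1 n \ s := by
    ext a
    simp only [Finset.mem_sdiff, Finset.mem_Icc, Finset.mem_insert]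
    grind
  have hsub : insert (n + 1) s ⊆ Finset.Icc 1 (n + 1) ↔ s ⊆ Finset.Icc 1 n := by
    rw [← Finset.insert_Icc_right_eq_Icc_add_one (by omega : 1 ≤ n + 1),
      Finset.insert_subset_insert_iff hs]
  rw [mem_markedSets, mem_markedSets, hdiff, hsub, Finset.card_insert_of_notMem hs,
    Nat.add_right_cancel_iff]

theorem markedSets_add_two_zero (n : ℕ) : markedSets (n + 2) 0 = markedSets n 0 := by
  ext s
  by_cases hs : n + 2 ∈ s
  · have hcard : s.card ≠ 0 := Finset.card_ne_zero_of_mem hs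
    simp [mem_markedSets, hcard]
  · exact mem_markedSets_add_two_iff_of_notMem hs

theorem markedSets_add_two_succ (n x : ℕ) :
    markedSets (n + 2) (x + 1) =
      (markedSets (n + 1) x).image (insert (n + 2)) ∪ markedSets n (x + 1) := by
  ext s
  rw [Finset.mem_union, Finset.mem_image]
  constructor
  · intro h
    by_cases hs : n + 2 ∈ s
    · refine Or.inl ⟨s.erase (n + 2), ?_, Finset.insert_erase hs⟩
      rw [← insert_mem_markedSets_succ_iff (Finset.notMem_erase _ _), Finset.insert_erase hs]
      exact h
    · exact Or.inr ((mem_markedSets_add_two_iff_of_notMem hs).1 h)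
  · rintro (⟨t, ht, rfl⟩ | h)
    · exact (insert_mem_markedSets_succ_iff (notMem_of_mem_markedSets ht (by omega))).2 ht
    · exact (mem_markedSets_add_two_iff_of_notMem
        (notMem_of_mem_markedSets h (by omega))).2 h

theorem card_markedSets_add_two_succ (n x : ℕ) :
    (markedSets (n + 2) (x + 1)).card =
      (markedSets (n + 1) x).card + (markedSets n (x + 1)).card := by
  rw [markedSets_add_two_succ, Finset.card_union_of_disjoint, Finset.card_image_of_injOn]
  · intro s hs t ht h
    have hs' := notMem_of_mem_markedSets hs (by omega : n + 1 < n + 2)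
    have ht' := notMem_of_mem_markedSets ht (by omega : n + 1 < n + 2)
    rw [← Finset.erase_insert hs', ← Finset.erase_insert ht']
    exact congrArg (Finset.erase · (n + 2)) h
  · rw [Finset.disjoint_left]
    intro s hs hs'
    obtain ⟨t, -, rfl⟩ := Finset.mem_image.1 hs
    exact notMem_of_mem_markedSets hs' (by omega : n < n + 2) (Finset.mem_insert_self _ _)

theorem markedSets_self (n : ℕ) : markedSets n n = {Finset.Icc 1 n} := by
  ext s
  rw [mem_markedSets, Finset.mem_singleton]
  constructor
  · rintro ⟨hsub, hcard, -⟩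
    exact Finset.eq_of_subset_of_card_le hsub (by simp [hcard])
  · rintro rfl
    simpa using pairable_empty

theorem card_markedSets_add_two_mul (x k : ℕ) :
    (markedSets (x + 2 * k) x).card = (x + k).choose k := by
  induction k generalizing x with
  | zero => simp [markedSets_self]
  | succ k ihk =>
    induction x with
    | zero =>
      rw [show 0 + 2 * (k + 1) = 0 + 2 * k + 2 by ring, markedSets_add_two_zero, ihk]
      simp
    | succ x ihx =>
      rw [show x + 1 + 2 * (k + 1) = x + 1 + 2 * k + 2 by ring, card_markedSets_add_two_succ,
        ihk, show x + 1 + 2 * k + 1 = x + 2 * (k + 1) by ring, ihx,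
        show x + 1 + (k + 1) = x + (k + 1) + 1 by ring, Nat.choose_succ_succ,
        show x + 1 + k = x + (k + 1) by ring, add_comm]

/-- For `x ≤ n` of the same parity,
`|A_x^n| = C((n+x)/2, (n−x)/2)`. -/
theorem card_markedSets (n x : ℕ) (hxn : x ≤ n) (hpar : n % 2 = x % 2) :
    (markedSets n x).card = Nat.choose ((n + x) / 2) ((n - x) / 2) := by
  obtain ⟨k, rfl⟩ : ∃ k, n = x + 2 * k := ⟨(n - x) / 2, by omega⟩
  rw [card_markedSets_add_two_mul, show (x + 2 * k + x) / 2 = x + k by omega,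
    show (x + 2 * k - x) / 2 = k by omega]
end
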